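/- arXiv:2205.00812 — 3 statements merged into one kernel-verified Lean document; each statement's English description precedes it below -/
import Mathlib

section
/- Let γ ∈ (0,2), T > 0 and G ∈ 𝒮. Then lim_{n → ∞} (1/n) · Σ_{x ∈ ℤ} sup_{s ∈ [0,T]} | n^γ (𝒦_n G)(s, x/n) − [−(−Δ)^{γ/2} G](s, x/n) | = 0, where (𝒦_n G)(s, x/n) := Σ_{y ∈ ℤ} [G(s, y/n) − G(s, x/n)] p(y−x). -/
open MeasureTheory Filter Set ENNReal

/-- Normalizing constant `c_γ = (Σ_{z ≠ 0} |z|^{-γ-1})⁻¹`. -/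
noncomputable def cGamma (γ : ℝ) : ℝ :=
  (∑' z : ℤ, if z = 0 then 0 else |(z : ℝ)| ^ (-γ - 1))⁻¹

/-- Transition probability `p(z) = c_γ |z|^{-γ-1}` for `z ≠ 0`, `p(0) = 0`. -/
noncomputable def transP (γ : ℝ) (z : ℤ) : ℝ :=
  if z = 0 then 0 else cGamma γ * |(z : ℝ)| ^ (-γ - 1)

/-- The space of test functions `𝒮 = P([0,T], C_c^∞(ℝ))`:
functions of the form `G(t,u) = Σ_{j=0}^k t^j G_j(u)` with `G_j` smooth compactly supported. -/
def IsTestS (G : ℝ → ℝ → ℝ) : Prop :=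
  ∃ k : ℕ, ∃ Gj : ℕ → ℝ → ℝ,
    (∀ j ≤ k, ContDiff ℝ (⊤ : ℕ∞) (Gj j) ∧ HasCompactSupport (Gj j)) ∧
    ∀ t u : ℝ, G t u = ∑ j ∈ Finset.range (k + 1), t ^ j * Gj j u

/-- The fractional Laplacian `-(-Δ)^{γ/2}` of a function `G : ℝ → ℝ`, defined as
`c_γ · lim_{ε → 0⁺} ∫_{|u-v| ≥ ε} (G(v) - G(u))/|u-v|^{1+γ} dv`. -/
noncomputable def fracLap (γ : ℝ) (G : ℝ → ℝ) (u : ℝ) : ℝ :=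
  cGamma γ * limUnder (nhdsWithin 0 (Set.Ioi 0))
    (fun ε : ℝ => ∫ v in {v : ℝ | ε ≤ |u - v|}, (G v - G u) / |u - v| ^ (1 + γ))

/-- The symmetric second difference of `F` at `u` with step `h`. -/
def secondDiff (F : ℝ → ℝ) (u h : ℝ) : ℝ := F (u + h) + F (u - h) - 2 * F u

/-- The symmetrized integrand of the fractional Laplacian. -/
noncomputable def levyIntegrand (γ : ℝ) (F : ℝ → ℝ) (u h : ℝ) : ℝ :=
  h ^ (-γ - 1) * secondDiff F u h

/-- The smallest point of the lattice `n⁻¹ ℕ` that is at least `h`. -/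
noncomputable def gridCeil (n : ℕ) (h : ℝ) : ℝ := (⌈h * n⌉₊ : ℝ) / n

/-- An integrable function dominating `levyIntegrand` and its lattice discretizations. -/
noncomputable def levyMajorant (γ h : ℝ) : ℝ :=
  if h ≤ 1 then h ^ (1 - γ) + 1 else h ^ (-γ - 1)

/-- The average `n⁻¹ ∑ |f (x / n)|` over the lattice `n⁻¹ ℤ`. -/
noncomputable def latticeMean (n : ℕ) (f : ℝ → ℝ) : ℝ≥0∞ :=
  (n : ℝ≥0∞)⁻¹ * ∑' x : ℤ, ENNReal.ofReal |f ((x : ℝ) / n)|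

/-- Quantitative properties of a compactly supported `C²` function, with a common constant. -/
structure HasTestBounds (F : ℝ → ℝ) (C : ℝ) : Prop where
  nonneg : 0 ≤ C
  continuous : Continuous F
  abs_apply_le : ∀ u, |F u| ≤ C
  abs_sub_le : ∀ u v, |F u - F v| ≤ C * |u - v|
  abs_secondDiff_le : ∀ u h, 0 ≤ h → |secondDiff F u h| ≤ C * h ^ 2
  eq_zero : ∀ u, C < |u| → F u = 0

theorem abs_secondDiff_le_of_lipschitz_deriv {F : ℝ → ℝ} (hF : Differentiable ℝ F) {K : ℝ}
    (hK : ∀ u v, |deriv F u - deriv F v| ≤ K * |u - v|) (u h : ℝ) (hh : 0 ≤ h) :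
    |secondDiff F u h| ≤ 2 * K * h ^ 2 := by
  have hK0 : 0 ≤ K := by simpa using (abs_nonneg _).trans (hK 1 0)
  have hd : ∀ t ∈ Icc 0 h, HasDerivWithinAt (secondDiff F u)
      (deriv F (u + t) - deriv F (u - t)) (Icc 0 h) t := by
    intro t _
    have h1 : HasDerivAt (fun t => F (u + t)) (deriv F (u + t)) t := by
      exact (hF (u + t)).hasDerivAt.comp_const_add u t
    have h2 : HasDerivAt (fun t => F (u - t)) (-deriv F (u - t)) t := by
      exact (hF (u - t)).hasDerivAt.comp_const_sub u t
    exact ((h1.add h2).sub_const (2 * F u)).hasDerivWithinAt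
  have hb : ∀ t ∈ Icc 0 h, ‖deriv F (u + t) - deriv F (u - t)‖ ≤ 2 * K * h := by
    intro t ht
    refine (hK _ _).trans ?_
    rw [show u + t - (u - t) = 2 * t by ring, abs_of_nonneg (by linarith [ht.1])]
    nlinarith [ht.2]
  have := Convex.norm_image_sub_le_of_norm_hasDerivWithin_le hd hb (convex_Icc 0 h)
    (left_mem_Icc.2 hh) (right_mem_Icc.2 hh)
  have h0 : secondDiff F u 0 = 0 := by simp [secondDiff]; ring
  rw [h0, sub_zero, sub_zero, Real.norm_eq_abs, Real.norm_eq_abs, abs_of_nonneg hh] at this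
  linarith

theorem exists_hasTestBounds {F : ℝ → ℝ} (hF : ContDiff ℝ (⊤ : ℕ∞) F)
    (hc : HasCompactSupport F) : ∃ C, HasTestBounds F C := by
  have hF' : ContDiff ℝ (⊤ : ℕ∞) (deriv F) := (contDiff_infty_iff_deriv.1 hF).2
  obtain ⟨L, hL⟩ := ContDiff.lipschitzWith_of_hasCompactSupport hc hF (by simp)
  obtain ⟨L', hL'⟩ := ContDiff.lipschitzWith_of_hasCompactSupport hc.deriv hF' (by simp)
  obtain ⟨A, hA⟩ := hF.continuous.bounded_above_of_compact_support hc
  obtain ⟨M, hM⟩ := hc.isCompact.isBounded.exists_norm_le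
  have hA0 : 0 ≤ A := (norm_nonneg _).trans (hA 0)
  have hs := abs_secondDiff_le_of_lipschitz_deriv (hF.differentiable (by simp))
    (K := L') (fun u v => by simpa [Real.dist_eq] using hL'.dist_le_mul u v)
  refine ⟨L + 2 * L' + A + |M|, ?_, hF.continuous, ?_, ?_, ?_, ?_⟩
  · positivity
  · intro u
    have := hA u
    rw [Real.norm_eq_abs] at this
    linarith [abs_nonneg M, NNReal.coe_nonneg L, NNReal.coe_nonneg L']
  · intro u v
    have := hL.dist_le_mul u v
    rw [Real.dist_eq, Real.dist_eq] at this
    refine this.trans (mul_le_mul_of_nonneg_right ?_ (abs_nonneg _))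
    linarith [abs_nonneg M, NNReal.coe_nonneg L, NNReal.coe_nonneg L']
  · intro u h hh
    refine (hs u h hh).trans (mul_le_mul_of_nonneg_right ?_ (sq_nonneg _))
    linarith [abs_nonneg M, NNReal.coe_nonneg L, NNReal.coe_nonneg L']
  · intro u hu
    by_contra hne
    have := hM u (subset_tsupport F hne)
    rw [Real.norm_eq_abs] at this
    linarith [le_abs_self M, NNReal.coe_nonneg L, NNReal.coe_nonneg L']

theorem latticeMean_add_le (n : ℕ) (f g : ℝ → ℝ) :
    latticeMean n (fun u => f u + g u) ≤ latticeMean n f + latticeMean n g := by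
  unfold latticeMean
  rw [← mul_add, ← ENNReal.tsum_add]
  gcongr with x
  exact (ENNReal.ofReal_le_ofReal (abs_add_le _ _)).trans ENNReal.ofReal_add_le

theorem latticeMean_const_mul (n : ℕ) (a : ℝ) (f : ℝ → ℝ) :
    latticeMean n (fun u => a * f u) = ENNReal.ofReal |a| * latticeMean n f := by
  simp only [latticeMean, abs_mul, ENNReal.ofReal_mul (abs_nonneg a), ENNReal.tsum_mul_left]
  ring

theorem latticeMean_le_of_support {n : ℕ} (hn : n ≠ 0) {f : ℝ → ℝ} {a R C : ℝ} (hR : 0 ≤ R)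
    (hC : 0 ≤ C) (hf : ∀ u, |f u| ≤ C) (hs : ∀ u, R < |u + a| → f u = 0) :
    latticeMean n f ≤ ENNReal.ofReal (C * (2 * R + 1)) := by
  have hn0 : (0 : ℝ) < n := by positivity
  have hn1 : (1 : ℝ) ≤ n := by exact_mod_cast Nat.one_le_iff_ne_zero.2 hn
  set s := Finset.Icc ⌈n * (-R - a)⌉ ⌊n * (R - a)⌋ with hsdef
  have hsum : ∑' x : ℤ, ENNReal.ofReal |f ((x : ℝ) / n)| =
      ∑ x ∈ s, ENNReal.ofReal |f ((x : ℝ) / n)| := by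
    refine tsum_eq_sum fun x hx => ?_
    rw [hs, abs_zero, ENNReal.ofReal_zero]
    by_contra! hle
    rw [abs_le] at hle
    refine hx (Finset.mem_Icc.2 ⟨Int.ceil_le.2 ?_, Int.le_floor.2 ?_⟩)
    · have : -R - a ≤ x / n := by linarith
      rw [le_div_iff₀ hn0] at this
      linarith
    · have : x / n ≤ R - a := by linarith
      rw [div_le_iff₀ hn0] at this
      linarith
  have hcard : (s.card : ℝ) ≤ n * (2 * R + 1) := by
    rw [hsdef, Int.card_Icc]
    rcases le_total 0 (⌊n * (R - a)⌋ + 1 - ⌈n * (-R - a)⌉) with h0 | h0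
    · have h1 : ((⌊n * (R - a)⌋ + 1 - ⌈n * (-R - a)⌉).toNat : ℝ) =
          (⌊n * (R - a)⌋ : ℝ) + 1 - ⌈n * (-R - a)⌉ := by
        rw [← Int.cast_natCast, Int.toNat_of_nonneg h0]; push_cast; ring
      rw [h1]
      have h2 := Int.floor_le (n * (R - a))
      have h3 := Int.le_ceil (n * (-R - a))
      nlinarith
    · rw [Int.toNat_of_nonpos h0]
      simp only [Nat.cast_zero]; positivity
  have hle : ∑ x ∈ s, ENNReal.ofReal |f ((x : ℝ) / n)| ≤
      n * ENNReal.ofReal (C * (2 * R + 1)) := by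
    calc _ ≤ ∑ x ∈ s, ENNReal.ofReal C :=
          Finset.sum_le_sum fun x _ => ENNReal.ofReal_le_ofReal (hf _)
      _ = ENNReal.ofReal (s.card * C) := by
          rw [Finset.sum_const, nsmul_eq_mul, ENNReal.ofReal_mul (by positivity),
            ENNReal.ofReal_natCast]
      _ ≤ ENNReal.ofReal (n * (C * (2 * R + 1))) :=
          ENNReal.ofReal_le_ofReal (by nlinarith)
      _ = _ := by rw [ENNReal.ofReal_mul (by positivity), ENNReal.ofReal_natCast]
  rw [latticeMean, hsum]
  calc _ ≤ (n : ℝ≥0∞)⁻¹ * (n * ENNReal.ofReal (C * (2 * R + 1))) := by gcongr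
    _ = _ := by
      rw [← mul_assoc, ENNReal.inv_mul_cancel (by exact_mod_cast hn) (ENNReal.natCast_ne_top n),
        one_mul]

theorem le_gridCeil {n : ℕ} (hn : n ≠ 0) (h : ℝ) : h ≤ gridCeil n h := by
  have hn0 : (0 : ℝ) < n := by positivity
  rw [gridCeil, le_div_iff₀ hn0]
  exact Nat.le_ceil _

theorem gridCeil_le {n : ℕ} (hn : n ≠ 0) {h : ℝ} (hh : 0 ≤ h) :
    gridCeil n h ≤ h + 1 / n := by
  have hn0 : (0 : ℝ) < n := by positivity
  rw [gridCeil, div_le_iff₀ hn0, add_mul, one_div, inv_mul_cancel₀ hn0.ne']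
  exact (Nat.ceil_lt_add_one (by positivity)).le

theorem tendsto_gridCeil {h : ℝ} (hh : 0 ≤ h) :
    Tendsto (fun n => gridCeil n h) atTop (nhds h) := by
  refine tendsto_of_tendsto_of_tendsto_of_le_of_le' tendsto_const_nhds
    (h := fun n : ℕ => h + 1 / (n : ℝ)) ?_ ?_ ?_
  · simpa using tendsto_one_div_atTop_nhds_zero_nat.const_add h
  · filter_upwards [eventually_ne_atTop 0] with n hn using le_gridCeil hn h
  · filter_upwards [eventually_ne_atTop 0] with n hn using gridCeil_le hn hh

theorem measurable_gridCeil (n : ℕ) : Measurable (gridCeil n) := by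
  unfold gridCeil
  exact ((measurable_from_top (f := ((↑) : ℕ → ℝ))).comp
    (Nat.measurable_ceil.comp (measurable_id.mul_const _))).div_const _

theorem levyMajorant_nonneg (γ : ℝ) {h : ℝ} (hh : 0 ≤ h) : 0 ≤ levyMajorant γ h := by
  unfold levyMajorant
  split_ifs <;> positivity

theorem rpow_mul_min_le_levyMajorant {γ : ℝ} (hγ : 0 < γ) {h h' : ℝ} (hh : 0 < h)
    (hle : h ≤ h') : h' ^ (-γ - 1) * min 1 (h' ^ 2) ≤ levyMajorant γ h := by
  have hh' : 0 < h' := hh.trans_le hle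
  have hpos : 0 < h' ^ (-γ - 1) := Real.rpow_pos_of_pos hh' _
  have hsq : h' ^ (-γ - 1) * h' ^ 2 = h' ^ (1 - γ) := by
    rw [← Real.rpow_natCast h' 2, ← Real.rpow_add hh']
    congr 1
    push_cast
    ring
  unfold levyMajorant
  split_ifs with h1
  · have hp : 0 < h ^ (1 - γ) := Real.rpow_pos_of_pos hh _
    rcases le_total h' 1 with h2 | h2
    · calc _ ≤ h' ^ (-γ - 1) * h' ^ 2 := by gcongr; exact min_le_right _ _
        _ ≤ _ := by
          rw [hsq]
          rcases le_total 0 (1 - γ) with h3 | h3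
          · linarith [Real.rpow_le_one hh'.le h2 h3]
          · linarith [Real.rpow_le_rpow_of_nonpos hh hle h3]
    · calc _ ≤ h' ^ (-γ - 1) * 1 := by gcongr; exact min_le_left _ _
        _ ≤ _ := by
          linarith [Real.rpow_le_one_of_one_le_of_nonpos h2 (by linarith : -γ - 1 ≤ 0)]
  · calc _ ≤ h' ^ (-γ - 1) * 1 := by gcongr; exact min_le_left _ _
      _ ≤ _ := by
        linarith [Real.rpow_le_rpow_of_nonpos hh hle (by linarith : -γ - 1 ≤ 0)]

theorem integrableOn_levyMajorant {γ : ℝ} (hγ : γ ∈ Ioo (0 : ℝ) 2) :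
    IntegrableOn (levyMajorant γ) (Ioi 0) := by
  rw [← Ioc_union_Ioi_eq_Ioi zero_le_one]
  refine IntegrableOn.union ?_ ?_
  · have h1 : IntegrableOn (fun h : ℝ => h ^ (1 - γ) + 1) (Ioc 0 1) :=
      ((intervalIntegrable_iff_integrableOn_Ioc_of_le zero_le_one).1
        (intervalIntegral.intervalIntegrable_rpow' (by linarith [hγ.2]))).add
        (integrableOn_const (by simp))
    refine h1.congr_fun (fun h hh => ?_) measurableSet_Ioc
    simp [levyMajorant, hh.2]
  · refine (integrableOn_Ioi_rpow_of_lt (by linarith [hγ.1] : -γ - 1 < -1) one_pos).congr_fun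
      (fun h hh => ?_) measurableSet_Ioi
    simp [levyMajorant, not_le.2 (mem_Ioi.1 hh)]

theorem HasTestBounds.continuous_secondDiff {F : ℝ → ℝ} {C : ℝ} (hF : HasTestBounds F C)
    (u : ℝ) : Continuous (secondDiff F u) := by
  have := hF.continuous
  unfold secondDiff
  fun_prop

theorem HasTestBounds.measurable_levyIntegrand {F : ℝ → ℝ} {C : ℝ} (hF : HasTestBounds F C)
    (γ u : ℝ) : Measurable (levyIntegrand γ F u) := by
  have := (hF.continuous_secondDiff u).measurable
  unfold levyIntegrand
  fun_prop

theorem HasTestBounds.abs_secondDiff_le_four {F : ℝ → ℝ} {C : ℝ} (hF : HasTestBounds F C)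
    (u h : ℝ) : |secondDiff F u h| ≤ 4 * C := by
  have h1 := abs_le.1 (hF.abs_apply_le (u + h))
  have h2 := abs_le.1 (hF.abs_apply_le (u - h))
  have h3 := abs_le.1 (hF.abs_apply_le u)
  unfold secondDiff
  rw [abs_le]
  constructor <;> linarith [h1.1, h1.2, h2.1, h2.2, h3.1, h3.2]

theorem HasTestBounds.secondDiff_eq_zero {F : ℝ → ℝ} {C : ℝ} (hF : HasTestBounds F C)
    {u h : ℝ} (hu : C + |h| < |u|) : secondDiff F u h = 0 := by
  have h1 : |u| ≤ |u + h| + |h| := by simpa using abs_sub (u + h) h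
  have h2 : |u| ≤ |u - h| + |h| := by simpa using abs_add_le (u - h) h
  rw [secondDiff, hF.eq_zero _ (by linarith), hF.eq_zero _ (by linarith),
    hF.eq_zero _ (by linarith [abs_nonneg h])]
  ring

theorem HasTestBounds.abs_levyIntegrand_le {F : ℝ → ℝ} {C : ℝ} (hF : HasTestBounds F C)
    {γ : ℝ} (hγ : 0 < γ) (u : ℝ) {h h' : ℝ} (hh : 0 < h) (hle : h ≤ h') :
    |levyIntegrand γ F u h'| ≤ 4 * C * levyMajorant γ h := by
  have hh' := hh.trans_le hle
  have hC := hF.nonneg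
  have hp := Real.rpow_pos_of_pos hh' (-γ - 1)
  have hD : |secondDiff F u h'| ≤ 4 * C * min 1 (h' ^ 2) := by
    rw [mul_min_of_nonneg _ _ (by positivity), mul_one]
    refine le_min (hF.abs_secondDiff_le_four u h') ?_
    nlinarith [hF.abs_secondDiff_le u h' hh'.le, mul_nonneg hC (sq_nonneg h')]
  rw [levyIntegrand, abs_mul, abs_of_pos hp]
  calc _ ≤ h' ^ (-γ - 1) * (4 * C * min 1 (h' ^ 2)) := by gcongr
    _ = 4 * C * (h' ^ (-γ - 1) * min 1 (h' ^ 2)) := by ring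
    _ ≤ _ := by gcongr; exact rpow_mul_min_le_levyMajorant hγ hh hle

theorem HasTestBounds.integrableOn_levyIntegrand {F : ℝ → ℝ} {C : ℝ} (hF : HasTestBounds F C)
    {γ : ℝ} (hγ : γ ∈ Ioo (0 : ℝ) 2) (u : ℝ) : IntegrableOn (levyIntegrand γ F u) (Ioi 0) := by
  refine ((integrableOn_levyMajorant hγ).const_mul (4 * C)).mono'
    (hF.measurable_levyIntegrand γ u).aestronglyMeasurable ?_
  filter_upwards [ae_restrict_mem measurableSet_Ioi] with h hh
  exact hF.abs_levyIntegrand_le hγ.1 u hh le_rfl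

theorem HasTestBounds.integrableOn_levyIntegrand_gridCeil {F : ℝ → ℝ} {C : ℝ}
    (hF : HasTestBounds F C) {γ : ℝ} (hγ : γ ∈ Ioo (0 : ℝ) 2) (u : ℝ) {n : ℕ} (hn : n ≠ 0) :
    IntegrableOn (fun h => levyIntegrand γ F u (gridCeil n h)) (Ioi 0) := by
  refine ((integrableOn_levyMajorant hγ).const_mul (4 * C)).mono'
    ((hF.measurable_levyIntegrand γ u).comp (measurable_gridCeil n)).aestronglyMeasurable ?_
  filter_upwards [ae_restrict_mem measurableSet_Ioi] with h hh
  exact hF.abs_levyIntegrand_le hγ.1 u hh (le_gridCeil hn h)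

theorem HasTestBounds.latticeMean_secondDiff_le {F : ℝ → ℝ} {C : ℝ} (hF : HasTestBounds F C)
    {n : ℕ} (hn : n ≠ 0) {h : ℝ} (hh : 0 ≤ h) :
    latticeMean n (fun u => secondDiff F u h) ≤
      ENNReal.ofReal (4 * C * (2 * C + 3) * min 1 (h ^ 2)) := by
  have hC := hF.nonneg
  rcases le_total h 1 with h1 | h1
  · rw [min_eq_right (by nlinarith)]
    refine (latticeMean_le_of_support hn (a := 0) (R := C + 1) (C := C * h ^ 2) (by positivity)
      (by positivity) (fun u => hF.abs_secondDiff_le u h hh) fun u hu => ?_).trans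
      (ENNReal.ofReal_le_ofReal ?_)
    · refine hF.secondDiff_eq_zero ?_
      rw [add_zero] at hu
      rw [abs_of_nonneg hh]
      linarith
    · have : 0 ≤ C * (2 * C + 3) * h ^ 2 := by positivity
      nlinarith
  · rw [min_eq_left (by nlinarith)]
    have hshift : ∀ a, latticeMean n (fun u => F (u + a)) ≤ ENNReal.ofReal (C * (2 * C + 1)) :=
      fun a => latticeMean_le_of_support hn hC hC (fun u => hF.abs_apply_le _)
        fun u hu => hF.eq_zero _ hu
    have heq : (fun u => secondDiff F u h) =
        fun u => (F (u + h) + F (u + -h)) + -2 * F (u + 0) := by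
      ext u
      simp only [secondDiff, add_zero, sub_eq_add_neg]
      ring
    rw [heq]
    calc _ ≤ latticeMean n (fun u => F (u + h)) + latticeMean n (fun u => F (u + -h)) +
          ENNReal.ofReal |-2| * latticeMean n (fun u => F (u + 0)) := by
          refine (latticeMean_add_le n _ _).trans (add_le_add (latticeMean_add_le n _ _) ?_)
          rw [latticeMean_const_mul]
      _ ≤ ENNReal.ofReal (C * (2 * C + 1)) + ENNReal.ofReal (C * (2 * C + 1)) +
          ENNReal.ofReal |-2| * ENNReal.ofReal (C * (2 * C + 1)) := by
          gcongr <;> apply hshift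
      _ = ENNReal.ofReal (4 * (C * (2 * C + 1))) := by
          rw [← ENNReal.ofReal_mul (abs_nonneg _), ← ENNReal.ofReal_add (by positivity)
            (by positivity), ← ENNReal.ofReal_add (by positivity) (by positivity)]
          congr 1
          norm_num
          ring
      _ ≤ _ := ENNReal.ofReal_le_ofReal (by nlinarith)

theorem HasTestBounds.latticeMean_levyIntegrand_le {F : ℝ → ℝ} {C : ℝ} (hF : HasTestBounds F C)
    {γ : ℝ} (hγ : 0 < γ) {n : ℕ} (hn : n ≠ 0) {h h' : ℝ} (hh : 0 < h) (hle : h ≤ h') :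
    latticeMean n (fun u => levyIntegrand γ F u h') ≤
      ENNReal.ofReal (4 * C * (2 * C + 3) * levyMajorant γ h) := by
  have hh' := hh.trans_le hle
  have hC := hF.nonneg
  have hp := Real.rpow_pos_of_pos hh' (-γ - 1)
  unfold levyIntegrand
  rw [latticeMean_const_mul, abs_of_pos hp]
  calc _ ≤ ENNReal.ofReal (h' ^ (-γ - 1)) *
        ENNReal.ofReal (4 * C * (2 * C + 3) * min 1 (h' ^ 2)) := by
        gcongr
        exact hF.latticeMean_secondDiff_le hn hh'.le
    _ = ENNReal.ofReal (4 * C * (2 * C + 3) * (h' ^ (-γ - 1) * min 1 (h' ^ 2))) := by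
        rw [← ENNReal.ofReal_mul hp.le]
        congr 1
        ring
    _ ≤ _ := by
        refine ENNReal.ofReal_le_ofReal ?_
        gcongr
        exact rpow_mul_min_le_levyMajorant hγ hh hle

theorem HasTestBounds.latticeMean_gridCeil_sub_le {F : ℝ → ℝ} {C : ℝ} (hF : HasTestBounds F C)
    {γ : ℝ} (hγ : 0 < γ) {n : ℕ} (hn : n ≠ 0) {h : ℝ} (hh : 0 < h) :
    latticeMean n (fun u => levyIntegrand γ F u (gridCeil n h) - levyIntegrand γ F u h) ≤
      ENNReal.ofReal (2 * (4 * C * (2 * C + 3)) * levyMajorant γ h) := by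
  have hC := hF.nonneg
  have hB := levyMajorant_nonneg γ hh.le
  have h1 := hF.latticeMean_levyIntegrand_le hγ hn hh (le_gridCeil hn h)
  have h2 : latticeMean n (fun u => -1 * levyIntegrand γ F u h) ≤
      ENNReal.ofReal (4 * C * (2 * C + 3) * levyMajorant γ h) := by
    rw [latticeMean_const_mul]
    simpa using hF.latticeMean_levyIntegrand_le hγ hn hh le_rfl
  have h3 := (latticeMean_add_le n _ _).trans (add_le_add h1 h2)
  rw [← ENNReal.ofReal_add (by positivity) (by positivity)] at h3
  simp only [neg_one_mul, ← sub_eq_add_neg] at h3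
  rwa [← two_mul, ← mul_assoc] at h3

theorem HasTestBounds.tendsto_latticeMean_gridCeil_sub {F : ℝ → ℝ} {C : ℝ}
    (hF : HasTestBounds F C) (γ : ℝ) {h : ℝ} (hh : 0 < h) :
    Tendsto (fun n =>
      latticeMean n (fun u => levyIntegrand γ F u (gridCeil n h) - levyIntegrand γ F u h))
      atTop (nhds 0) := by
  have hC := hF.nonneg
  have hp := Real.rpow_pos_of_pos hh (-γ - 1)
  set b : ℝ → ℝ := fun h' => |h' ^ (-γ - 1) - h ^ (-γ - 1)| * (4 * C * (2 * C + 3)) +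
    h ^ (-γ - 1) * (2 * C * |h' - h| * (2 * (C + (h + 1)) + 1)) with hb
  have hbc : ContinuousAt b h := by
    have : ContinuousAt (fun h' : ℝ => h' ^ (-γ - 1)) h :=
      Real.continuousAt_rpow_const _ _ (Or.inl hh.ne')
    fun_prop
  have hlim : Tendsto (fun n => ENNReal.ofReal (b (gridCeil n h))) atTop (nhds 0) := by
    have h1 := ENNReal.tendsto_ofReal (hbc.tendsto.comp (tendsto_gridCeil hh.le))
    have h0 : b h = 0 := by simp [hb]
    rwa [h0, ENNReal.ofReal_zero] at h1
  refine tendsto_of_tendsto_of_tendsto_of_le_of_le' tendsto_const_nhds hlim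
    (Eventually.of_forall fun _ => zero_le) ?_
  filter_upwards [eventually_ne_atTop 0] with n hn
  have hle := le_gridCeil hn h
  have hle' : gridCeil n h ≤ h + 1 := by
    refine (gridCeil_le hn hh.le).trans ?_
    gcongr
    rw [one_div]
    exact inv_le_one_of_one_le₀ (by exact_mod_cast Nat.one_le_iff_ne_zero.2 hn)
  set h' := gridCeil n h
  have hh' : 0 < h' := hh.trans_le hle
  have heq : (fun u => levyIntegrand γ F u h' - levyIntegrand γ F u h) =
      fun u => (h' ^ (-γ - 1) - h ^ (-γ - 1)) * secondDiff F u h' +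
        h ^ (-γ - 1) * (secondDiff F u h' - secondDiff F u h) := by
    ext u
    simp only [levyIntegrand]
    ring
  have hD : latticeMean n (fun u => secondDiff F u h' - secondDiff F u h) ≤
      ENNReal.ofReal (2 * C * |h' - h| * (2 * (C + (h + 1)) + 1)) := by
    refine latticeMean_le_of_support hn (a := 0) (by positivity) (by positivity) (fun u => ?_)
      fun u hu => ?_
    · have h1 := hF.abs_sub_le (u + h') (u + h)
      have h2 := hF.abs_sub_le (u - h') (u - h)
      rw [show u + h' - (u + h) = h' - h by ring] at h1
      rw [show u - h' - (u - h) = -(h' - h) by ring, abs_neg] at h2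
      rw [show secondDiff F u h' - secondDiff F u h =
        (F (u + h') - F (u + h)) + (F (u - h') - F (u - h)) by simp only [secondDiff]; ring]
      linarith [abs_add_le (F (u + h') - F (u + h)) (F (u - h') - F (u - h))]
    · rw [add_zero] at hu
      rw [hF.secondDiff_eq_zero (by rw [abs_of_pos hh']; linarith),
        hF.secondDiff_eq_zero (by rw [abs_of_pos hh]; linarith), sub_zero]
  rw [heq]
  calc _ ≤ ENNReal.ofReal |h' ^ (-γ - 1) - h ^ (-γ - 1)| *
          latticeMean n (fun u => secondDiff F u h') +
        ENNReal.ofReal |h ^ (-γ - 1)| *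
          latticeMean n (fun u => secondDiff F u h' - secondDiff F u h) := by
        refine (latticeMean_add_le n _ _).trans ?_
        rw [latticeMean_const_mul, latticeMean_const_mul]
    _ ≤ ENNReal.ofReal |h' ^ (-γ - 1) - h ^ (-γ - 1)| * ENNReal.ofReal (4 * C * (2 * C + 3)) +
        ENNReal.ofReal |h ^ (-γ - 1)| *
          ENNReal.ofReal (2 * C * |h' - h| * (2 * (C + (h + 1)) + 1)) := by
        gcongr
        refine (hF.latticeMean_secondDiff_le hn hh'.le).trans (ENNReal.ofReal_le_ofReal ?_)
        exact mul_le_of_le_one_right (by positivity) (min_le_left _ _)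
    _ = _ := by
        rw [abs_of_pos hp, ← ENNReal.ofReal_mul (abs_nonneg _), ← ENNReal.ofReal_mul hp.le,
          ← ENNReal.ofReal_add (by positivity) (by positivity)]

theorem HasTestBounds.tendsto_lintegral_latticeMean {F : ℝ → ℝ} {C : ℝ}
    (hF : HasTestBounds F C) {γ : ℝ} (hγ : γ ∈ Ioo (0 : ℝ) 2) :
    Tendsto (fun n : ℕ => (n : ℝ≥0∞)⁻¹ * ∑' x : ℤ, ∫⁻ h in Ioi 0, ENNReal.ofReal
      |levyIntegrand γ F (x / n) (gridCeil n h) - levyIntegrand γ F (x / n) h|)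
      atTop (nhds 0) := by
  have hmeas : ∀ (n : ℕ) (u : ℝ), Measurable fun h => ENNReal.ofReal
      |levyIntegrand γ F u (gridCeil n h) - levyIntegrand γ F u h| := fun n u =>
    (((hF.measurable_levyIntegrand γ u).comp (measurable_gridCeil n)).sub
      (hF.measurable_levyIntegrand γ u)).abs.ennreal_ofReal
  have hmean : ∀ n : ℕ, Measurable fun h => latticeMean n
      (fun u => levyIntegrand γ F u (gridCeil n h) - levyIntegrand γ F u h) := fun n =>
    (Measurable.tsum fun x : ℤ => hmeas n _).const_mul _
  set B : ℝ → ℝ≥0∞ := fun h =>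
    ENNReal.ofReal (2 * (4 * C * (2 * C + 3)) * levyMajorant γ h)
  have hswap : ∀ n : ℕ, (n : ℝ≥0∞)⁻¹ * ∑' x : ℤ, ∫⁻ h in Ioi 0, ENNReal.ofReal
      |levyIntegrand γ F (x / n) (gridCeil n h) - levyIntegrand γ F (x / n) h| =
      ∫⁻ h in Ioi 0, latticeMean n
        (fun u => levyIntegrand γ F u (gridCeil n h) - levyIntegrand γ F u h) := by
    intro n
    simp only [latticeMean]
    rw [lintegral_const_mul _ (Measurable.tsum fun x : ℤ => hmeas n _),
      lintegral_tsum fun x : ℤ => (hmeas n _).aemeasurable]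
  simp_rw [hswap]
  rw [← tendsto_add_atTop_iff_nat 1, ← lintegral_zero (μ := volume.restrict (Ioi (0 : ℝ)))]
  refine tendsto_lintegral_of_dominated_convergence' B (fun n => (hmean _).aemeasurable)
    (fun n => ?_) ?_ ?_
  · filter_upwards [ae_restrict_mem measurableSet_Ioi] with h hh
    exact hF.latticeMean_gridCeil_sub_le hγ.1 n.succ_ne_zero hh
  · exact ((integrableOn_levyMajorant hγ).const_mul _).lintegral_lt_top.ne
  · filter_upwards [ae_restrict_mem measurableSet_Ioi] with h hh
    exact (hF.tendsto_latticeMean_gridCeil_sub γ hh).comp (tendsto_add_atTop_nat 1)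

theorem HasTestBounds.integrableOn_Ici_jump {F : ℝ → ℝ} {C : ℝ} (hF : HasTestBounds F C)
    {γ ε : ℝ} (hγ : 0 < γ) (hε : 0 < ε) (u : ℝ) {φ : ℝ → ℝ} (hφ : Continuous φ) :
    IntegrableOn (fun h => h ^ (-γ - 1) * (F (φ h) - F u)) (Ici ε) := by
  have hF' := hF.continuous
  have hm : Measurable fun h => h ^ (-γ - 1) * (F (φ h) - F u) := by
    have : Measurable fun h => F (φ h) - F u := (by fun_prop : Continuous _).measurable
    fun_prop
  rw [integrableOn_Ici_iff_integrableOn_Ioi]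
  refine ((integrableOn_Ioi_rpow_of_lt (by linarith : -γ - 1 < -1) hε).const_mul
    (2 * C)).mono' hm.aestronglyMeasurable ?_
  filter_upwards [ae_restrict_mem measurableSet_Ioi] with h hh
  have hp := Real.rpow_pos_of_pos (hε.trans hh) (-γ - 1)
  rw [Real.norm_eq_abs, abs_mul, abs_of_pos hp, mul_comm]
  gcongr
  linarith [abs_sub (F (φ h)) (F u), hF.abs_apply_le (φ h), hF.abs_apply_le u]

theorem HasTestBounds.setIntegral_truncated_eq {F : ℝ → ℝ} {C : ℝ} (hF : HasTestBounds F C)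
    {γ ε : ℝ} (hγ : 0 < γ) (hε : 0 < ε) (u : ℝ) :
    ∫ v in {v : ℝ | ε ≤ |u - v|}, (F v - F u) / |u - v| ^ (1 + γ) =
      ∫ h in Ici ε, levyIntegrand γ F u h := by
  set f : ℝ → ℝ := fun v => (F v - F u) / |u - v| ^ (1 + γ) with hf
  have hset : {v : ℝ | ε ≤ |u - v|} = Ici (u + ε) ∪ Iic (u - ε) := by
    ext v
    simp only [mem_ofPred_eq, le_abs, mem_union, mem_Ici, mem_Iic]
    constructor
    · rintro (h | h)
      · right; linarith
      · left; linarith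
    · rintro (h | h)
      · right; linarith
      · left; linarith
  have hpre₁ : (fun h => u + h) ⁻¹' Ici (u + ε) = Ici ε := by ext; simp
  have hpre₂ : (fun h => u - h) ⁻¹' Iic (u - ε) = Ici ε := by ext; simp
  have hmp₁ := measurePreserving_add_left (volume : Measure ℝ) u
  have hmp₂ := Measure.measurePreserving_sub_left (volume : Measure ℝ) u
  have hemb₁ : MeasurableEmbedding fun h : ℝ => u + h := measurableEmbedding_addLeft u
  have hemb₂ : MeasurableEmbedding fun h : ℝ => u - h :=
    (Homeomorph.subLeft u).measurableEmbedding
  have hpow : ∀ h ∈ Ici ε, ∀ a : ℝ, a / |h| ^ (1 + γ) = h ^ (-γ - 1) * a := by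
    intro h hh a
    have hh0 : 0 < h := hε.trans_le hh
    rw [abs_of_pos hh0, show -γ - 1 = -(1 + γ) by ring, Real.rpow_neg hh0.le]
    ring
  have he₁ : EqOn (fun h => f (u + h)) (fun h => h ^ (-γ - 1) * (F (u + h) - F u)) (Ici ε) := by
    intro h hh
    simp only [hf]
    rw [sub_add_cancel_left, abs_neg, hpow h hh]
  have he₂ : EqOn (fun h => f (u - h)) (fun h => h ^ (-γ - 1) * (F (u - h) - F u)) (Ici ε) := by
    intro h hh
    simp only [hf]
    rw [_root_.sub_sub_cancel, hpow h hh]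
  have hi₁ := hF.integrableOn_Ici_jump hγ hε u (φ := fun h => u + h) (by fun_prop)
  have hi₂ := hF.integrableOn_Ici_jump hγ hε u (φ := fun h => u - h) (by fun_prop)
  have hI₁ : IntegrableOn f (Ici (u + ε)) := by
    rw [← hmp₁.integrableOn_comp_preimage hemb₁, hpre₁]
    exact hi₁.congr_fun he₁.symm measurableSet_Ici
  have hI₂ : IntegrableOn f (Iic (u - ε)) := by
    rw [← hmp₂.integrableOn_comp_preimage hemb₂, hpre₂]
    exact hi₂.congr_fun he₂.symm measurableSet_Ici
  have hdisj : Disjoint (Ici (u + ε)) (Iic (u - ε)) := by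
    rw [Set.disjoint_left]
    intro v h1 h2
    rw [mem_Ici] at h1
    rw [mem_Iic] at h2
    linarith
  rw [hset, setIntegral_union hdisj measurableSet_Iic hI₁ hI₂,
    ← hmp₁.setIntegral_preimage_emb hemb₁ f (Ici (u + ε)),
    ← hmp₂.setIntegral_preimage_emb hemb₂ f (Iic (u - ε)), hpre₁, hpre₂,
    setIntegral_congr_fun measurableSet_Ici he₁, setIntegral_congr_fun measurableSet_Ici he₂,
    ← integral_add hi₁ hi₂]
  refine integral_congr_ae (Eventually.of_forall fun h => ?_)
  simp only [levyIntegrand, secondDiff]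
  ring

theorem HasTestBounds.fracLap_eq {F : ℝ → ℝ} {C : ℝ} (hF : HasTestBounds F C)
    {γ : ℝ} (hγ : γ ∈ Ioo (0 : ℝ) 2) (u : ℝ) :
    fracLap γ F u = cGamma γ * ∫ h in Ioi 0, levyIntegrand γ F u h := by
  have hcov : AECover (volume.restrict (Ioi (0 : ℝ))) (nhdsWithin 0 (Ioi (0 : ℝ)))
      fun ε => Ici ε := aecover_Ioi_of_Ici (tendsto_nhdsWithin_of_tendsto_nhds tendsto_id)
  have hlim := hcov.integral_tendsto_of_countably_generated (hF.integrableOn_levyIntegrand hγ u)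
  rw [fracLap]
  congr 1
  refine Tendsto.limUnder_eq (hlim.congr' ?_)
  filter_upwards [self_mem_nhdsWithin] with ε hε
  rw [hF.setIntegral_truncated_eq hγ.1 hε, Measure.restrict_restrict measurableSet_Ici,
    inter_eq_left.2 (Ici_subset_Ioi.2 hε)]

theorem cGamma_nonneg (γ : ℝ) : 0 ≤ cGamma γ := by
  refine inv_nonneg.2 (tsum_nonneg fun z => ?_)
  split_ifs <;> positivity

theorem summable_transP {γ : ℝ} (hγ : 0 < γ) : Summable (transP γ) := by
  have h := (Real.summable_abs_int_rpow (by linarith : 1 < γ + 1)).mul_left (cGamma γ)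
  refine Summable.of_norm_bounded h fun z => ?_
  have hc := cGamma_nonneg γ
  rw [transP, neg_add']
  split_ifs
  · rw [norm_zero]
    positivity
  · rw [Real.norm_eq_abs, abs_of_nonneg (by positivity)]

theorem HasTestBounds.integral_gridCeil_eq_tsum {F : ℝ → ℝ} {C : ℝ} (hF : HasTestBounds F C)
    {γ : ℝ} (hγ : γ ∈ Ioo (0 : ℝ) 2) (u : ℝ) {n : ℕ} (hn : n ≠ 0) :
    ∫ h in Ioi 0, levyIntegrand γ F u (gridCeil n h) =
      ∑' k : ℕ, 1 / (n : ℝ) * levyIntegrand γ F u (((k : ℝ) + 1) / n) := by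
  have hn0 : (0 : ℝ) < n := by positivity
  set s : ℕ → Set ℝ := fun k => Ioc ((k : ℝ) / n) (((k : ℝ) + 1) / n) with hs
  have hceil : ∀ k : ℕ, ∀ h, h ∈ s k ↔ ⌈h * n⌉₊ = k + 1 := by
    intro k h
    rw [Nat.ceil_eq_iff k.succ_ne_zero, hs, mem_Ioc, div_lt_iff₀ hn0, le_div_iff₀ hn0]
    simp
  have hunion : ⋃ k, s k = Ioi 0 := by
    ext h
    simp only [mem_iUnion, hceil, mem_Ioi]
    constructor
    · rintro ⟨k, hk⟩
      have : 0 < h * n := Nat.ceil_pos.1 (by omega)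
      exact pos_of_mul_pos_left this hn0.le
    · intro hh
      have := Nat.ceil_pos.2 (mul_pos hh hn0)
      exact ⟨⌈h * n⌉₊ - 1, by omega⟩
  have hdisj : Pairwise (Function.onFun Disjoint s) := by
    intro i j hij
    rw [Function.onFun, Set.disjoint_left]
    intro h hi hj
    rw [hceil] at hi hj
    omega
  have hint := hF.integrableOn_levyIntegrand_gridCeil hγ u hn
  rw [← hunion] at hint ⊢
  rw [← (hasSum_integral_iUnion (fun k => measurableSet_Ioc) hdisj hint).tsum_eq]
  refine tsum_congr fun k => ?_
  have he : EqOn (fun h => levyIntegrand γ F u (gridCeil n h))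
      (fun _ => levyIntegrand γ F u (((k : ℝ) + 1) / n)) (s k) := by
    intro h hh
    simp only [gridCeil, (hceil k h).1 hh]
    push_cast
    rfl
  rw [setIntegral_congr_fun measurableSet_Ioc he, setIntegral_const, smul_eq_mul,
    Real.volume_real_Ioc_of_le (by gcongr; linarith)]
  congr 1
  ring

theorem HasTestBounds.generator_eq {F : ℝ → ℝ} {C : ℝ} (hF : HasTestBounds F C)
    {γ : ℝ} (hγ : γ ∈ Ioo (0 : ℝ) 2) {n : ℕ} (hn : n ≠ 0) (x : ℤ) :
    (n : ℝ) ^ γ * (∑' y : ℤ, (F ((y : ℝ) / n) - F ((x : ℝ) / n)) * transP γ (y - x)) =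
      cGamma γ * ∫ h in Ioi 0, levyIntegrand γ F (x / n) (gridCeil n h) := by
  have hn0 : (0 : ℝ) < n := by positivity
  set f : ℤ → ℝ := fun z => (F (((x + z : ℤ) : ℝ) / n) - F ((x : ℝ) / n)) * transP γ z with hf
  have hsum : Summable f := by
    refine Summable.of_norm_bounded ((summable_transP hγ.1).abs.mul_left (2 * C)) fun z => ?_
    rw [Real.norm_eq_abs, abs_mul]
    gcongr
    linarith [abs_sub (F (((x + z : ℤ) : ℝ) / n)) (F ((x : ℝ) / n)),
      hF.abs_apply_le (((x + z : ℤ) : ℝ) / n), hF.abs_apply_le ((x : ℝ) / n)]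
  have hpos : Summable fun k : ℕ => f (k + 1) :=
    hsum.comp_injective (i := fun k : ℕ => (k : ℤ) + 1) fun a b h => by simpa using h
  have hneg : Summable fun k : ℕ => f (-(k + 1)) :=
    hsum.comp_injective (i := fun k : ℕ => -((k : ℤ) + 1)) fun a b h => by simpa using h
  have hshift : ∑' y : ℤ, (F ((y : ℝ) / n) - F ((x : ℝ) / n)) * transP γ (y - x) =
      ∑' z, f z := by
    rw [← (Equiv.addLeft x).tsum_eq]
    simp [hf]
  have hf0 : f 0 = 0 := by simp [hf]
  rw [hshift, tsum_of_add_one_of_neg_add_one hpos hneg, hf0, add_zero, ← hpos.tsum_add hneg,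
    hF.integral_gridCeil_eq_tsum hγ _ hn, ← tsum_mul_left, ← tsum_mul_left]
  refine tsum_congr fun k => ?_
  have hk : (0 : ℝ) < (k : ℝ) + 1 := by positivity
  have hk1 : ((k : ℤ) + 1) ≠ 0 := by omega
  have hk2 : (-((k : ℤ) + 1)) ≠ 0 := by omega
  have hscale : (n : ℝ) ^ γ * ((k : ℝ) + 1) ^ (-γ - 1) =
      1 / n * (((k : ℝ) + 1) / n) ^ (-γ - 1) := by
    rw [Real.div_rpow hk.le hn0.le, Real.rpow_sub_one hn0.ne', Real.rpow_neg hn0.le]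
    have := (Real.rpow_pos_of_pos hn0 γ).ne'
    field_simp
  have hval : f (k + 1) + f (-(k + 1)) = cGamma γ * (((k : ℝ) + 1) ^ (-γ - 1) *
      secondDiff F (x / n) (((k : ℝ) + 1) / n)) := by
    simp only [hf, transP, if_neg hk1, if_neg hk2, secondDiff]
    push_cast
    rw [abs_neg, abs_of_pos hk, add_div (x : ℝ) (k + 1), add_div (x : ℝ) (-(k + 1)), neg_div,
      ← sub_eq_add_neg]
    ring
  rw [hval, levyIntegrand]
  linear_combination cGamma γ * secondDiff F (x / n) (((k : ℝ) + 1) / n) * hscale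

theorem HasTestBounds.generator_sub_fracLap_eq {F : ℝ → ℝ} {C : ℝ} (hF : HasTestBounds F C)
    {γ : ℝ} (hγ : γ ∈ Ioo (0 : ℝ) 2) {n : ℕ} (hn : n ≠ 0) (x : ℤ) :
    (n : ℝ) ^ γ * (∑' y : ℤ, (F ((y : ℝ) / n) - F ((x : ℝ) / n)) * transP γ (y - x)) -
        fracLap γ F (x / n) =
      cGamma γ * ∫ h in Ioi 0,
        (levyIntegrand γ F (x / n) (gridCeil n h) - levyIntegrand γ F (x / n) h) := by
  rw [hF.generator_eq hγ hn, hF.fracLap_eq hγ, ← mul_sub,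
    integral_sub (hF.integrableOn_levyIntegrand_gridCeil hγ _ hn)
      (hF.integrableOn_levyIntegrand hγ _)]

theorem levyIntegrand_sum {ι : Type*} (γ : ℝ) (s : Finset ι) (a : ι → ℝ) (F : ι → ℝ → ℝ)
    (u h : ℝ) : levyIntegrand γ (fun v => ∑ j ∈ s, a j * F j v) u h =
      ∑ j ∈ s, a j * levyIntegrand γ (F j) u h := by
  simp only [levyIntegrand, secondDiff, Finset.mul_sum, ← Finset.sum_add_distrib,
    ← Finset.sum_sub_distrib]
  exact Finset.sum_congr rfl fun j _ => by ring

/-- Proposition: `n^γ 𝒦_n G` converges to the fractional Laplacian of `G`. -/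
theorem statement1 (γ T : ℝ) (hγ : γ ∈ Set.Ioo (0 : ℝ) 2) (hT : 0 < T)
    (G : ℝ → ℝ → ℝ) (hG : IsTestS G) :
    Filter.Tendsto
      (fun n : ℕ =>
        (n : ℝ≥0∞)⁻¹ *
          ∑' x : ℤ, ⨆ s ∈ Set.Icc (0 : ℝ) T, ENNReal.ofReal
            |(n : ℝ) ^ γ *
                (∑' y : ℤ, (G s ((y : ℝ) / n) - G s ((x : ℝ) / n)) * transP γ (y - x))
              - fracLap γ (fun u => G s u) ((x : ℝ) / n)|)
      Filter.atTop (nhds 0) := by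
  obtain ⟨k, Gj, hGj, hGsum⟩ := hG
  have hmem : ∀ j ∈ Finset.range (k + 1), j ≤ k := fun j hj =>
    Nat.lt_succ_iff.1 (Finset.mem_range.1 hj)
  have hGs : ∀ s, ∃ C, HasTestBounds (fun u => G s u) C := by
    intro s
    have h : ContDiff ℝ (⊤ : ℕ∞) (∑ j ∈ Finset.range (k + 1), fun u => s ^ j * Gj j u) ∧
        HasCompactSupport (∑ j ∈ Finset.range (k + 1), fun u => s ^ j * Gj j u) := by
      refine Finset.sum_induction _
        (fun F : ℝ → ℝ => ContDiff ℝ (⊤ : ℕ∞) F ∧ HasCompactSupport F)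
        (fun F F' h h' => ⟨h.1.add h'.1, h.2.add h'.2⟩)
        ⟨contDiff_const, HasCompactSupport.zero⟩ fun j hj => ?_
      obtain ⟨h1, h2⟩ := hGj j (hmem j hj)
      exact ⟨contDiff_const.mul h1, h2.mul_left⟩
    have he : (fun u => G s u) = ∑ j ∈ Finset.range (k + 1), fun u => s ^ j * Gj j u := by
      ext u
      rw [hGsum, Finset.sum_apply]
    rw [he]
    exact exists_hasTestBounds h.1 h.2
  set I : ℕ → ℕ → ℤ → ℝ≥0∞ := fun j n x => ∫⁻ h in Ioi 0, ENNReal.ofReal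
    |levyIntegrand γ (Gj j) (x / n) (gridCeil n h) - levyIntegrand γ (Gj j) (x / n) h|
  have hle : ∀ n : ℕ, n ≠ 0 → ∀ x : ℤ, ∀ s ∈ Icc 0 T, ENNReal.ofReal
      |(n : ℝ) ^ γ *
          (∑' y : ℤ, (G s ((y : ℝ) / n) - G s ((x : ℝ) / n)) * transP γ (y - x))
        - fracLap γ (fun u => G s u) ((x : ℝ) / n)| ≤
      ∑ j ∈ Finset.range (k + 1), ENNReal.ofReal (cGamma γ * T ^ j) * I j n x := by
    intro n hn x s hs
    obtain ⟨C, hC⟩ := hGs s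
    have hmeas : ∀ j ∈ Finset.range (k + 1), Measurable fun h => ENNReal.ofReal
        |levyIntegrand γ (Gj j) (x / n) (gridCeil n h) - levyIntegrand γ (Gj j) (x / n) h| := by
      intro j hj
      obtain ⟨C', hC'⟩ := exists_hasTestBounds (hGj j (hmem j hj)).1 (hGj j (hmem j hj)).2
      exact (((hC'.measurable_levyIntegrand γ _).comp (measurable_gridCeil n)).sub
        (hC'.measurable_levyIntegrand γ _)).abs.ennreal_ofReal
    rw [hC.generator_sub_fracLap_eq hγ hn x, abs_mul, abs_of_nonneg (cGamma_nonneg γ),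
      ENNReal.ofReal_mul (cGamma_nonneg γ), ← Real.enorm_eq_ofReal_abs]
    simp_rw [ENNReal.ofReal_mul (cGamma_nonneg γ), mul_assoc, ← Finset.mul_sum]
    gcongr
    refine (enorm_integral_le_lintegral_enorm _).trans ?_
    rw [← Finset.sum_congr rfl fun j hj => lintegral_const_mul _ (hmeas j hj),
      ← lintegral_finsetSum _ fun j hj => (hmeas j hj).const_mul _]
    refine lintegral_mono fun h => ?_
    have hGeq : (fun u => G s u) = fun u => ∑ j ∈ Finset.range (k + 1), s ^ j * Gj j u :=
      funext (hGsum s)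
    rw [hGeq, levyIntegrand_sum, levyIntegrand_sum, ← Finset.sum_sub_distrib,
      Real.enorm_eq_ofReal_abs]
    simp_rw [← ENNReal.ofReal_mul (pow_nonneg hT.le _)]
    rw [← ENNReal.ofReal_sum_of_nonneg fun j _ => by positivity]
    refine ENNReal.ofReal_le_ofReal ((Finset.abs_sum_le_sum_abs _ _).trans ?_)
    refine Finset.sum_le_sum fun j _ => ?_
    rw [← mul_sub, abs_mul, abs_of_nonneg (pow_nonneg hs.1 j)]
    gcongr
    · exact hs.1
    · exact hs.2
  have hlim : Tendsto (fun n : ℕ => ∑ j ∈ Finset.range (k + 1),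
      ENNReal.ofReal (cGamma γ * T ^ j) * ((n : ℝ≥0∞)⁻¹ * ∑' x : ℤ, I j n x))
      atTop (nhds 0) := by
    rw [← Finset.sum_const_zero (s := Finset.range (k + 1))]
    refine tendsto_finsetSum _ fun j hj => ?_
    obtain ⟨C, hC⟩ := exists_hasTestBounds (hGj j (hmem j hj)).1 (hGj j (hmem j hj)).2
    have := ENNReal.Tendsto.const_mul (a := ENNReal.ofReal (cGamma γ * T ^ j))
      (hC.tendsto_lintegral_latticeMean hγ) (Or.inr ENNReal.ofReal_ne_top)
    rwa [mul_zero] at this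
  refine tendsto_of_tendsto_of_tendsto_of_le_of_le' tendsto_const_nhds hlim
    (Eventually.of_forall fun _ => zero_le) ?_
  filter_upwards [eventually_ne_atTop 0] with n hn
  calc _ ≤ (n : ℝ≥0∞)⁻¹ * ∑' x : ℤ, ∑ j ∈ Finset.range (k + 1),
        ENNReal.ofReal (cGamma γ * T ^ j) * I j n x := by
        gcongr with x
        exact iSup₂_le (hle n hn x)
    _ = _ := by
        rw [Summable.tsum_finsetSum fun _ _ => ENNReal.summable, Finset.mul_sum]
        refine Finset.sum_congr rfl fun j _ => ?_
        rw [ENNReal.tsum_mul_left, mul_left_comm]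
end

section
/- Let γ ∈ (0,2), T > 0 and G ∈ 𝒮. Then for every integer n ≥ 1 the sum (1/n) · Σ_{x ∈ ℤ} sup_{s ∈ [0,T]} | [−(−Δ)^{γ/2} G](s, x/n) | is finite. -/
open MeasureTheory Filter Set ENNReal

open scoped Topology

theorem integrable_comp_abs_of_integrableOn_Ioi {f : ℝ → ℝ} (hf : IntegrableOn f (Ioi 0)) :
    Integrable fun x => f |x| := by
  have h1 : IntegrableOn (fun x => f |x|) (Ioi 0) :=
    hf.congr_fun (fun x hx => by simp [abs_of_pos (show (0 : ℝ) < x from hx)]) measurableSet_Ioi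
  have h2 : IntegrableOn (fun x => f |x|) (Iic 0) := by
    rw [← Measure.map_neg_eq_self (volume : Measure ℝ)]
    let m : MeasurableEmbedding fun x : ℝ => -x := (Homeomorph.neg ℝ).measurableEmbedding
    rw [m.integrableOn_map_iff]
    simp_rw [Function.comp_def, abs_neg, neg_preimage, neg_Iic, neg_zero]
    exact (integrableOn_Ici_iff_integrableOn_Ioi (by finiteness)).2 h1
  rw [← integrableOn_univ, ← Iic_union_Ioi (a := (0 : ℝ))]
  exact h2.union h1

theorem integrable_min_sq_one_div_abs_rpow {γ : ℝ} (hγ : γ ∈ Ioo (0 : ℝ) 2) :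
    Integrable fun w : ℝ => min (|w| ^ 2) 1 / |w| ^ (1 + γ) := by
  refine integrable_comp_abs_of_integrableOn_Ioi
    (f := fun r => min (r ^ 2) 1 / r ^ (1 + γ)) ?_
  rw [← Ioc_union_Ioi_eq_Ioi (zero_le_one (α := ℝ))]
  refine IntegrableOn.union ?_ ?_
  · have h : IntegrableOn (fun r : ℝ => r ^ (1 - γ)) (Ioc 0 1) :=
      (intervalIntegrable_iff_integrableOn_Ioc_of_le zero_le_one).1
        (intervalIntegral.intervalIntegrable_rpow' (by linarith [hγ.2]))
    refine h.congr_fun (fun r hr => ?_) measurableSet_Ioc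
    have hr0 : 0 < r := hr.1
    have : r ^ 2 ≤ 1 := pow_le_one₀ hr0.le hr.2
    simp only [min_eq_left this]
    rw [← Real.rpow_natCast r 2, ← Real.rpow_sub hr0]
    congr 1
    push_cast
    ring
  · refine (integrableOn_Ioi_rpow_of_lt (a := -(1 + γ)) (by linarith [hγ.1])
      zero_lt_one).congr_fun (fun r hr => ?_) measurableSet_Ioi
    have hr1 : 1 < r := hr
    have : 1 ≤ r ^ 2 := one_le_pow₀ hr1.le
    simp only [min_eq_right this]
    rw [Real.rpow_neg (by linarith), one_div]

theorem integrableOn_one_div_abs_sub_rpow {γ ε : ℝ} (hγ : 0 < γ) (hε : 0 < ε) (u : ℝ) :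
    IntegrableOn (fun v : ℝ => 1 / |u - v| ^ (1 + γ)) {v : ℝ | ε ≤ |u - v|} := by
  have hm : MeasurableSet {v : ℝ | ε ≤ |u - v|} :=
    measurableSet_le measurable_const (by fun_prop)
  have h : IntegrableOn ((Ici ε).indicator fun r : ℝ => r ^ (-(1 + γ))) (Ioi 0) := by
    refine Integrable.integrableOn ?_
    rw [integrable_indicator_iff measurableSet_Ici, integrableOn_Ici_iff_integrableOn_Ioi]
    exact integrableOn_Ioi_rpow_of_lt (by linarith) hε
  have h2 := (integrable_comp_abs_of_integrableOn_Ioi h).comp_sub_left u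
  rw [← integrable_indicator_iff hm]
  refine h2.congr (Eventually.of_forall fun v => ?_)
  by_cases hv : ε ≤ |u - v|
  · simp only [indicator, mem_Ici, mem_ofPred_eq, hv, if_true]
    rw [Real.rpow_neg (abs_nonneg _), one_div]
  · simp [hv, indicator]

theorem integrableOn_sub_div_abs_sub_rpow {γ ε : ℝ} (hγ : 0 < γ) (hε : 0 < ε) {F : ℝ → ℝ}
    (hF : Continuous F) (hc : HasCompactSupport F) (u : ℝ) :
    IntegrableOn (fun v : ℝ => (F v - F u) / |u - v| ^ (1 + γ)) {v : ℝ | ε ≤ |u - v|} := by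
  obtain ⟨M, hM⟩ := hc.exists_bound_of_continuous hF
  have h := Integrable.bdd_mul (c := M + M) (integrableOn_one_div_abs_sub_rpow hγ hε u)
    (f := fun v => F v - F u) (by fun_prop)
    (Eventually.of_forall fun v => (norm_sub_le _ _).trans (add_le_add (hM v) (hM u)))
  simp only [mul_one_div] at h
  exact h

theorem exists_abs_second_difference_le {F : ℝ → ℝ} (hF : ContDiff ℝ 2 F)
    (hc : HasCompactSupport F) :
    ∃ K : ℝ, ∀ u w : ℝ, |F (u - w) + F (u + w) - 2 * F u| ≤ K * min (|w| ^ 2) 1 := by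
  obtain ⟨M, hM⟩ := hc.exists_bound_of_continuous hF.continuous
  have hd : ContDiff ℝ 1 (deriv F) := ((contDiff_succ_iff_deriv (n := 1)).1 hF).2.2
  obtain ⟨C, hC⟩ := ContDiff.lipschitzWith_of_hasCompactSupport hc.deriv hd one_ne_zero
  have hM0 : 0 ≤ M := (norm_nonneg _).trans (hM 0)
  have hdiff : Differentiable ℝ F := hF.differentiable (by norm_num)
  have hsq : ∀ u w : ℝ, 0 ≤ w → |F (u - w) + F (u + w) - 2 * F u| ≤ 2 * C * w ^ 2 := by
    intro u w hw
    have key := norm_image_sub_le_of_norm_deriv_le_segment' (a := 0) (b := w)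
      (f := fun t => F (u - t) + F (u + t)) (f' := fun t => -deriv F (u - t) + deriv F (u + t))
      (C := 2 * C * w) (fun x _ => ?_) (fun x hx => ?_) w ⟨hw, le_rfl⟩
    · simp only [sub_zero, add_zero, Real.norm_eq_abs] at key
      calc _ = |F (u - w) + F (u + w) - (F u + F u)| := by ring_nf
        _ ≤ _ := key
        _ = _ := by ring
    · have h1 : HasDerivAt (fun t => F (u - t)) (-deriv F (u - x)) x := by
        simpa using (hdiff (u - x)).hasDerivAt.comp_const_sub u x
      have h2 : HasDerivAt (fun t => F (u + t)) (deriv F (u + x)) x := by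
        simpa using (hdiff (u + x)).hasDerivAt.comp_const_add u x
      exact (h1.add h2).hasDerivWithinAt
    · have h := hC.dist_le_mul (u + x) (u - x)
      rw [Real.dist_eq, Real.dist_eq, show u + x - (u - x) = 2 * x by ring,
        abs_of_nonneg (by linarith [hx.1] : 0 ≤ 2 * x)] at h
      rw [Real.norm_eq_abs, neg_add_eq_sub]
      have : (C : ℝ) * x ≤ C * w := mul_le_mul_of_nonneg_left hx.2.le C.2
      linarith
  refine ⟨max (2 * C) (4 * M), fun u w => ?_⟩
  have h1 : |F (u - w) + F (u + w) - 2 * F u| ≤ 2 * C * |w| ^ 2 := by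
    rcases abs_cases w with ⟨h, _⟩ | ⟨h, _⟩
    · rw [h]; exact hsq u w (by linarith)
    · rw [h]
      have := hsq u (-w) (by linarith)
      rwa [sub_neg_eq_add, ← sub_eq_add_neg, add_comm (F (u + w))] at this
  have h2 : |F (u - w) + F (u + w) - 2 * F u| ≤ 4 * M := by
    have a1 := abs_le.1 (hM (u - w))
    have a2 := abs_le.1 (hM (u + w))
    have a3 := abs_le.1 (hM u)
    rw [abs_le]
    constructor <;> linarith
  rcases min_cases (|w| ^ 2) (1 : ℝ) with ⟨h, _⟩ | ⟨h, _⟩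
  · rw [h]
    exact h1.trans (mul_le_mul_of_nonneg_right (le_max_left _ _) (by positivity))
  · rw [h, mul_one]
    exact h2.trans (le_max_right _ _)

theorem two_mul_setIntegral_eq_integral_second_difference {γ ε : ℝ} (hγ : 0 < γ) (hε : 0 < ε)
    {F : ℝ → ℝ} (hF : Continuous F) (hc : HasCompactSupport F) (u : ℝ) :
    2 * ∫ v in {v : ℝ | ε ≤ |u - v|}, (F v - F u) / |u - v| ^ (1 + γ) =
      ∫ w, {w : ℝ | ε ≤ |w|}.indicator
        (fun w => (F (u - w) + F (u + w) - 2 * F u) / |w| ^ (1 + γ)) w := by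
  have hm : MeasurableSet {v : ℝ | ε ≤ |u - v|} :=
    measurableSet_le measurable_const (by fun_prop)
  have hi := (integrable_indicator_iff hm).2 (integrableOn_sub_div_abs_sub_rpow hγ hε hF hc u)
  rw [← integral_indicator hm, two_mul]
  nth_rw 1 [← integral_sub_left_eq_self _ volume u]
  nth_rw 2 [← integral_add_left_eq_self _ u]
  rw [← integral_add (hi.comp_sub_left u) (hi.comp_add_left u)]
  refine integral_congr_ae (Eventually.of_forall fun w => ?_)
  by_cases hw : ε ≤ |w|
  · have h1 : u - w ∈ {v : ℝ | ε ≤ |u - v|} := by simpa using hw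
    have h2 : u + w ∈ {v : ℝ | ε ≤ |u - v|} := by simpa using hw
    have h3 : w ∈ {w : ℝ | ε ≤ |w|} := hw
    simp only [indicator_of_mem h1, indicator_of_mem h2, indicator_of_mem h3]
    rw [_root_.sub_sub_cancel, sub_add_cancel_left, abs_neg]
    ring
  · simp [indicator, hw]

theorem exists_tendsto_truncated_fracLap {γ : ℝ} (hγ : γ ∈ Ioo (0 : ℝ) 2) {F : ℝ → ℝ}
    (hF : ContDiff ℝ 2 F) (hc : HasCompactSupport F) (u : ℝ) :
    ∃ L : ℝ, Tendsto (fun ε : ℝ => ∫ v in {v : ℝ | ε ≤ |u - v|}, (F v - F u) / |u - v| ^ (1 + γ))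
      (𝓝[>] 0) (𝓝 L) := by
  obtain ⟨K, hK⟩ := exists_abs_second_difference_le hF hc
  have hcont := hF.continuous
  have hlim : Tendsto (fun ε : ℝ => ∫ w, {w : ℝ | ε ≤ |w|}.indicator
        (fun w => (F (u - w) + F (u + w) - 2 * F u) / |w| ^ (1 + γ)) w) (𝓝[>] 0)
      (𝓝 (∫ w, (F (u - w) + F (u + w) - 2 * F u) / |w| ^ (1 + γ))) := by
    refine tendsto_integral_filter_of_dominated_convergence
      (fun w => K * (min (|w| ^ 2) 1 / |w| ^ (1 + γ))) ?_ ?_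
      ((integrable_min_sq_one_div_abs_rpow hγ).const_mul K) ?_
    · refine Eventually.of_forall fun ε => Measurable.aestronglyMeasurable ?_
      refine Measurable.indicator ?_ (measurableSet_le measurable_const (by fun_prop))
      have := hcont.measurable
      fun_prop
    · refine Eventually.of_forall fun ε => Eventually.of_forall fun w => ?_
      refine (norm_indicator_le_norm_self _ _).trans ?_
      rw [norm_div, Real.norm_eq_abs, Real.norm_eq_abs,
        abs_of_nonneg (Real.rpow_nonneg (abs_nonneg w) _), ← mul_div_assoc]
      exact div_le_div_of_nonneg_right (hK u w) (Real.rpow_nonneg (abs_nonneg w) _)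
    · refine (ae_iff.2 (by simp) : ∀ᵐ w : ℝ, w ≠ 0).mono fun w hw => ?_
      refine tendsto_const_nhds.congr' ?_
      filter_upwards [nhdsWithin_le_nhds (Iio_mem_nhds (abs_pos.2 hw))] with ε hε
      rw [indicator_of_mem (show w ∈ {w : ℝ | ε ≤ |w|} from (mem_Iio.1 hε).le)]
  refine ⟨_, (hlim.const_mul (1 / 2)).congr' ?_⟩
  filter_upwards [self_mem_nhdsWithin] with ε hε
  rw [← two_mul_setIntegral_eq_integral_second_difference hγ.1 hε hcont hc u]
  ring

theorem tendsto_fracLap {γ : ℝ} (hγ : γ ∈ Ioo (0 : ℝ) 2) {F : ℝ → ℝ}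
    (hF : ContDiff ℝ 2 F) (hc : HasCompactSupport F) (u : ℝ) :
    Tendsto (fun ε : ℝ => cGamma γ *
      ∫ v in {v : ℝ | ε ≤ |u - v|}, (F v - F u) / |u - v| ^ (1 + γ))
      (𝓝[>] 0) (𝓝 (fracLap γ F u)) := by
  obtain ⟨L, hL⟩ := exists_tendsto_truncated_fracLap hγ hF hc u
  rw [fracLap, hL.limUnder_eq]
  exact hL.const_mul _

theorem fracLap_sum {ι : Type*} {γ : ℝ} (hγ : γ ∈ Ioo (0 : ℝ) 2) (s : Finset ι) (a : ι → ℝ)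
    {F : ι → ℝ → ℝ} (hF : ∀ i ∈ s, ContDiff ℝ 2 (F i))
    (hc : ∀ i ∈ s, HasCompactSupport (F i)) (u : ℝ) :
    fracLap γ (fun v => ∑ i ∈ s, a i * F i v) u = ∑ i ∈ s, a i * fracLap γ (F i) u := by
  choose! L hL using fun i (hi : i ∈ s) =>
    exists_tendsto_truncated_fracLap hγ (hF i hi) (hc i hi) u
  have hsum : Tendsto (fun ε : ℝ => ∫ v in {v : ℝ | ε ≤ |u - v|},
      (∑ i ∈ s, a i * F i v - ∑ i ∈ s, a i * F i u) / |u - v| ^ (1 + γ))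
      (𝓝[>] 0) (𝓝 (∑ i ∈ s, a i * L i)) := by
    refine (tendsto_finsetSum s fun i hi => (hL i hi).const_mul (a i)).congr' ?_
    filter_upwards [self_mem_nhdsWithin] with ε hε
    simp_rw [← integral_const_mul]
    rw [← integral_finsetSum s fun i hi => (integrableOn_sub_div_abs_sub_rpow hγ.1 hε
      (hF i hi).continuous (hc i hi) u).const_mul (a i)]
    refine integral_congr_ae (Eventually.of_forall fun v => ?_)
    simp only [← Finset.sum_sub_distrib, Finset.sum_div]
    exact Finset.sum_congr rfl fun i _ => by ring
  rw [fracLap, hsum.limUnder_eq, Finset.mul_sum]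
  refine Finset.sum_congr rfl fun i hi => ?_
  rw [fracLap, (hL i hi).limUnder_eq]
  ring

theorem exists_abs_fracLap_le {γ : ℝ} (hγ : γ ∈ Ioo (0 : ℝ) 2) {F : ℝ → ℝ}
    (hF : ContDiff ℝ 2 F) (hc : HasCompactSupport F) :
    ∃ A R : ℝ, 0 < R ∧ ∀ u : ℝ, R ≤ |u| → |fracLap γ F u| ≤ A * |u| ^ (-(1 + γ)) := by
  obtain ⟨R, hR0, hR⟩ : ∃ R : ℝ, 0 < R ∧ ∀ v, R < |v| → F v = 0 := by
    obtain ⟨R, hR0, hR⟩ := hc.isCompact.isBounded.exists_pos_norm_le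
    refine ⟨R, hR0, fun v hv => image_eq_zero_of_notMem_tsupport fun h => ?_⟩
    exact absurd (hR v h) (not_le.2 hv)
  have hint : Integrable fun v => ‖F v‖ := (hF.continuous.integrable_of_hasCompactSupport hc).norm
  refine ⟨|cGamma γ| * (∫ v, ‖F v‖) * 2 ^ (1 + γ), 2 * R + 1, by positivity, fun u hu => ?_⟩
  have hu0 : 0 < |u| := by linarith
  have hFu : F u = 0 := hR u (by linarith)
  refine le_of_tendsto (tendsto_fracLap hγ hF hc u).abs (Eventually.of_forall fun ε => ?_)
  rw [abs_mul, mul_assoc, mul_assoc]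
  refine mul_le_mul_of_nonneg_left ?_ (abs_nonneg _)
  have hscale : (2 : ℝ) ^ (1 + γ) * |u| ^ (-(1 + γ)) = 1 / (|u| / 2) ^ (1 + γ) := by
    rw [Real.div_rpow hu0.le zero_le_two, Real.rpow_neg hu0.le, one_div_div, div_eq_mul_inv]
  rw [hscale, ← integral_mul_const, ← Real.norm_eq_abs]
  refine (norm_integral_le_of_norm_le (hint.mul_const _).integrableOn
    (Eventually.of_forall fun v => ?_)).trans (setIntegral_le_integral (hint.mul_const _)
      (Eventually.of_forall fun v => by positivity))
  rw [hFu, sub_zero, norm_div]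
  by_cases hv : R < |v|
  · simp [hR v hv]
  · have h1 : |u| / 2 ≤ |u - v| := by
      have := abs_sub_abs_le_abs_sub u v
      linarith
    rw [← mul_one_div, Real.norm_eq_abs (_ ^ _),
      abs_of_nonneg (Real.rpow_nonneg (abs_nonneg _) _)]
    refine mul_le_mul_of_nonneg_left (one_div_le_one_div_of_le (by positivity) ?_) (norm_nonneg _)
    exact Real.rpow_le_rpow (by positivity) h1 (by linarith [hγ.1])

theorem summable_abs_fracLap_div {γ : ℝ} (hγ : γ ∈ Ioo (0 : ℝ) 2) {F : ℝ → ℝ}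
    (hF : ContDiff ℝ 2 F) (hc : HasCompactSupport F) {n : ℕ} (hn : 1 ≤ n) :
    Summable fun x : ℤ => |fracLap γ F ((x : ℝ) / n)| := by
  obtain ⟨A, R, -, hA⟩ := exists_abs_fracLap_le hγ hF hc
  have hn0 : (0 : ℝ) < n := by exact_mod_cast hn
  refine Summable.of_norm_bounded_eventually
    ((Real.summable_abs_int_rpow (b := 1 + γ) (by linarith [hγ.1])).mul_left
      (A * (n : ℝ) ^ (1 + γ))) ?_
  have hlarge : ∀ᶠ x : ℤ in cofinite, R * n ≤ |(x : ℝ)| :=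
    (tendsto_norm_cocompact_atTop.comp Int.tendsto_coe_cofinite).eventually_ge_atTop (R * n)
  filter_upwards [hlarge] with x hx
  have habs : |(x : ℝ) / n| = |(x : ℝ)| / n := by rw [abs_div, abs_of_pos hn0]
  have h := hA (x / n) (by rwa [habs, le_div_iff₀ hn0])
  rw [Real.norm_eq_abs, abs_abs]
  refine h.trans_eq ?_
  rw [habs, Real.div_rpow (abs_nonneg _) hn0.le, Real.rpow_neg hn0.le, div_inv_eq_mul]
  ring

/-- for `G ∈ 𝒮`, the sum `(1/n) Σ_x sup_{s ∈ [0,T]} |[-(-Δ)^{γ/2} G](s, x/n)|`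
is finite for every `n ≥ 1`. -/
theorem statement3 (γ T : ℝ) (hγ : γ ∈ Set.Ioo (0 : ℝ) 2) (hT : 0 < T)
    (G : ℝ → ℝ → ℝ) (hG : IsTestS G) :
    ∀ n : ℕ, 1 ≤ n →
      (n : ℝ≥0∞)⁻¹ *
        ∑' x : ℤ, ⨆ s ∈ Set.Icc (0 : ℝ) T, ENNReal.ofReal
          |fracLap γ (fun u => G s u) ((x : ℝ) / n)| < ⊤ := by
  intro n hn
  obtain ⟨k, F, hF, hG⟩ := hG
  have hsmooth : ∀ j ∈ Finset.range (k + 1), ContDiff ℝ 2 (F j) := fun j hj =>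
    contDiff_infty.1 (hF j (Finset.mem_range_succ_iff.1 hj)).1 2
  have hsupp : ∀ j ∈ Finset.range (k + 1), HasCompactSupport (F j) := fun j hj =>
    (hF j (Finset.mem_range_succ_iff.1 hj)).2
  have hsum : Summable fun x : ℤ =>
      ∑ j ∈ Finset.range (k + 1), T ^ j * |fracLap γ (F j) ((x : ℝ) / n)| :=
    summable_sum fun j hj =>
      (summable_abs_fracLap_div hγ (hsmooth j hj) (hsupp j hj) hn).mul_left _
  refine ENNReal.mul_lt_top (by simp; omega) (lt_of_le_of_lt (ENNReal.tsum_le_tsum fun x => ?_)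
    hsum.tsum_ofReal_lt_top)
  refine iSup₂_le fun s hs => ENNReal.ofReal_le_ofReal ?_
  simp_rw [hG]
  rw [fracLap_sum hγ _ _ hsmooth hsupp]
  refine (Finset.abs_sum_le_sum_abs _ _).trans (Finset.sum_le_sum fun j _ => ?_)
  rw [abs_mul, abs_of_nonneg (pow_nonneg hs.1 j)]
  exact mul_le_mul_of_nonneg_right (pow_le_pow_left₀ hs.1 hs.2 j) (abs_nonneg _)
end

section
/- Moving Particle Lemma. Let γ ∈ (0,2). There exists a constant C > 0 (depending only on γ) such that for every b ∈ (0,1), every r ∈ ℤ with r ≠ 0, and every density f with respect to ν_b (i.e. f : Ω → [0,∞) measurable with ∫_Ω f dν_b = 1), it holds Σ_{x ∈ ℤ} ∫_{Ω_x} ( √(f(η^{x,x+r})) − √(f(η)) )² dν_b(η) ≤ C · |r|^γ · 𝒟(√f, ν_b), where Ω_x := { η ∈ Ω : η(x−2) = η(x−1) = 1 }. -/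
open MeasureTheory Filter Set ENNReal

/-- The configuration space `Ω = {0,1}^ℤ`, with `true` meaning an occupied site. -/
abbrev Config := ℤ → Bool

/-- The configuration `η^{x,y}` obtained from `η` by exchanging the values at `x` and `y`. -/
def swapConf (x y : ℤ) (η : Config) : Config :=
  fun z => if z = x then η y else if z = y then η x else η z

/-- Occupation number `η(x) ∈ {0,1}` as a real number. -/
def ind (b : Bool) : ℝ := if b then 1 else 0

/-- The kinetic constraint `c̃_{x,y}(η) = η(x-1) + η(x+1) + η(y-1) + η(y+1)`. -/
noncomputable def ctilde (x y : ℤ) (η : Config) : ℝ :=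
  ind (η (x - 1)) + ind (η (x + 1)) + ind (η (y - 1)) + ind (η (y + 1))

/-- `ν` is the Bernoulli product measure with parameter `b` on `Ω = {0,1}^ℤ`:
a probability measure whose cylinder sets have the i.i.d. Bernoulli(`b`) probabilities. -/
def IsBernoulliProduct (b : ℝ) (ν : MeasureTheory.Measure Config) : Prop :=
  MeasureTheory.IsProbabilityMeasure ν ∧
    ∀ (s : Finset ℤ) (a : ℤ → Bool),
      ν {η : Config | ∀ x ∈ s, η x = a x} =
        ∏ x ∈ s, ENNReal.ofReal (if a x then b else 1 - b)

/-- The Dirichlet form `𝒟(√f, ν_b) = (1/4) Σ_{x,y} p(x-y) I_{x,y}(√f, ν_b)`, where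
`I_{x,y}(√f, ν_b) = ∫ c̃_{x,y}(η) (√f(η^{x,y}) - √f(η))² dν_b`. -/
noncomputable def dirichletForm (γ : ℝ) (ν : MeasureTheory.Measure Config)
    (f : Config → ℝ) : ℝ≥0∞ :=
  (1 / 4) * ∑' q : ℤ × ℤ, ENNReal.ofReal (transP γ (q.1 - q.2)) *
    ∫⁻ η, ENNReal.ofReal (ctilde q.1 q.2 η *
      (Real.sqrt (f (swapConf q.1 q.2 η)) - Real.sqrt (f η)) ^ 2) ∂ν

lemma cGamma_pos {γ : ℝ} (hγ : 0 < γ) : 0 < cGamma γ := by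
  have hsum : Summable fun z : ℤ => |(z : ℝ)| ^ (-γ - 1) := by
    have := Real.summable_abs_int_rpow (b := γ + 1) (by linarith)
    simpa [neg_add, sub_eq_add_neg, add_comm] using this
  have hnonneg : ∀ z : ℤ, 0 ≤ if z = 0 then (0 : ℝ) else |(z : ℝ)| ^ (-γ - 1) := fun z => by
    split_ifs <;> positivity
  refine inv_pos.2 (Summable.tsum_pos (hsum.of_nonneg_of_le hnonneg fun z => ?_) hnonneg 1 ?_)
  · split_ifs
    · positivity
    · rfl
  · simp

lemma one_le_mul_transP {γ : ℝ} (hγ : 0 < γ) {z : ℤ} (hz : z ≠ 0) {L : ℝ}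
    (hL : |(z : ℝ)| ≤ L) : 1 ≤ L ^ (γ + 1) / cGamma γ * transP γ z := by
  have hc := cGamma_pos hγ
  have hz' : 0 < |(z : ℝ)| := abs_pos.2 (by exact_mod_cast hz)
  have hpow : |(z : ℝ)| ^ (γ + 1) ≤ L ^ (γ + 1) :=
    Real.rpow_le_rpow hz'.le hL (by linarith)
  have hneg : |(z : ℝ)| ^ (-γ - 1) = (|(z : ℝ)| ^ (γ + 1))⁻¹ := by
    rw [← Real.rpow_neg hz'.le]; congr 1; ring
  have hpos : 0 < |(z : ℝ)| ^ (γ + 1) := Real.rpow_pos_of_pos hz' _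
  rw [transP, if_neg hz, hneg]
  field_simp
  exact hpow

lemma measurable_swapConf (x y : ℤ) : Measurable (swapConf x y) := by
  refine measurable_pi_lambda _ fun z => ?_
  unfold swapConf
  split_ifs <;> exact measurable_pi_apply _

lemma swapConf_apply (x y : ℤ) (η : Config) (z : ℤ) :
    swapConf x y η z = η (Equiv.swap x y z) := by
  simp only [swapConf, Equiv.swap_apply_def]
  split_ifs <;> rfl

/-- Bernoulli product measures are invariant under exchanging two sites. -/
lemma IsBernoulliProduct.measurePreserving_swapConf {b : ℝ} {ν : Measure Config}
    (hν : IsBernoulliProduct b ν) (x y : ℤ) : MeasurePreserving (swapConf x y) ν ν := by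
  have := hν.1
  have := Measure.isProbabilityMeasure_map (μ := ν) (measurable_swapConf x y).aemeasurable
  refine ⟨measurable_swapConf x y, ?_⟩
  refine IsProjectiveLimit.unique (P := fun s : Finset ℤ => ν.map s.restrict) ?_ (fun _ => rfl)
  intro s
  refine Measure.ext_of_singleton fun a => ?_
  have hr : Measurable (s.restrict : Config → _) := Finset.measurable_restrict s
  set a' : ℤ → Bool := fun z => if hz : z ∈ s then a ⟨z, hz⟩ else false with ha'
  have hpre : (s.restrict : Config → _) ⁻¹' {a} = {η : Config | ∀ z ∈ s, η z = a' z} := by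
    ext η
    simp only [mem_preimage, mem_singleton_iff, funext_iff, Finset.restrict, Subtype.forall,
      mem_ofPred_eq, ha']
    exact forall₂_congr fun z hz => by rw [dif_pos hz]
  have hpre' : swapConf x y ⁻¹' {η : Config | ∀ z ∈ s, η z = a' z} =
      {η : Config | ∀ z ∈ s.image (Equiv.swap x y), η z = a' (Equiv.swap x y z)} := by
    ext η
    simp [swapConf_apply]
  rw [Measure.map_apply hr (measurableSet_singleton a), Measure.map_apply hr
    (measurableSet_singleton a), Measure.map_apply (measurable_swapConf x y)
    (hr (measurableSet_singleton a)), hpre, hpre', hν.2, hν.2 s a',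
    Finset.prod_image (Equiv.injective _).injOn]
  simp

lemma ind_nonneg (b : Bool) : 0 ≤ ind b := by
  unfold ind; split_ifs <;> norm_num

lemma measurable_ctilde (x y : ℤ) : Measurable (ctilde x y) := by
  have h : Measurable ind := measurable_of_countable _
  have h' (z : ℤ) : Measurable fun η : Config => ind (η z) := h.comp (measurable_pi_apply z)
  exact (((h' _).add (h' _)).add (h' _)).add (h' _)

lemma one_le_ctilde {x y z : ℤ} {η : Config} (hη : η z = true)
    (hz : z = x - 1 ∨ z = x + 1 ∨ z = y - 1 ∨ z = y + 1) : 1 ≤ ctilde x y η := by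
  have h : ind (η z) = 1 := by simp [ind, hη]
  have h₁ := ind_nonneg (η (x - 1))
  have h₂ := ind_nonneg (η (x + 1))
  have h₃ := ind_nonneg (η (y - 1))
  have h₄ := ind_nonneg (η (y + 1))
  unfold ctilde
  rcases hz with rfl | rfl | rfl | rfl <;> linarith

/-- The integrand of the Dirichlet form at the bond `x, y`, for a function `g` in place of `√f`. -/
noncomputable def bondCost (g : Config → ℝ) (x y : ℤ) (η : Config) : ℝ≥0∞ :=
  ENNReal.ofReal (ctilde x y η * (g (swapConf x y η) - g η) ^ 2)

lemma measurable_bondCost {g : Config → ℝ} (hg : Measurable g) (x y : ℤ) :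
    Measurable (bondCost g x y) :=
  ((measurable_ctilde x y).mul
    (((hg.comp (measurable_swapConf x y)).sub hg).pow_const 2)).ennreal_ofReal

lemma ofReal_sq_le_bondCost (g : Config → ℝ) {x y : ℤ} {η : Config} (h : 1 ≤ ctilde x y η) :
    ENNReal.ofReal ((g (swapConf x y η) - g η) ^ 2) ≤ bondCost g x y η :=
  ENNReal.ofReal_le_ofReal (le_mul_of_one_le_left (sq_nonneg _) h)

lemma ofReal_sq_sub_le_five (a₀ a₁ a₂ a₃ a₄ a₅ : ℝ) :
    ENNReal.ofReal ((a₅ - a₀) ^ 2) ≤ 5 * (ENNReal.ofReal ((a₁ - a₀) ^ 2) +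
      ENNReal.ofReal ((a₂ - a₁) ^ 2) + ENNReal.ofReal ((a₃ - a₂) ^ 2) +
      ENNReal.ofReal ((a₄ - a₃) ^ 2) + ENNReal.ofReal ((a₅ - a₄) ^ 2)) := by
  rw [← ENNReal.ofReal_add (by positivity) (by positivity),
    ← ENNReal.ofReal_add (by positivity) (by positivity),
    ← ENNReal.ofReal_add (by positivity) (by positivity),
    ← ENNReal.ofReal_add (by positivity) (by positivity),
    show (5 : ℝ≥0∞) = ENNReal.ofReal 5 by simp, ← ENNReal.ofReal_mul (by norm_num)]
  refine ENNReal.ofReal_le_ofReal ?_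
  have h := sq_sum_le_card_mul_sum_sq (s := Finset.univ)
    (f := ![a₁ - a₀, a₂ - a₁, a₃ - a₂, a₄ - a₃, a₅ - a₄])
  simp [Fin.sum_univ_five] at h
  linarith

/-- The exchange of `x` and `x + r` factors through a far away site `x + k`: the particle at
`x - 2` is first sent to `x + k - 1`, next to that site, and is finally brought back. -/
lemma swapConf_eq_five_swaps {x r k : ℤ} (hr : r ≠ 0) (hr2 : r ≠ -2) (hk : |r| + 2 ≤ k)
    (η : Config) :
    swapConf (x - 2) (x + k - 1) (swapConf x (x + k) (swapConf (x + k) (x + r)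
      (swapConf x (x + k) (swapConf (x - 2) (x + k - 1) η)))) = swapConf x (x + r) η := by
  have h1 := le_abs_self r
  have h2 := neg_le_abs r
  funext z
  simp only [swapConf]
  grind

lemma ofReal_sq_le_path (g : Config → ℝ) {x r k : ℤ} (hr : r ≠ 0) (hr1 : r ≠ -1)
    (hr2 : r ≠ -2) (hk : |r| + 2 ≤ k) {η : Config} (hη2 : η (x - 2) = true)
    (hη1 : η (x - 1) = true) :
    ENNReal.ofReal ((g (swapConf x (x + r) η) - g η) ^ 2) ≤
      5 * (bondCost g (x - 2) (x + k - 1) η +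
        bondCost g x (x + k) (swapConf (x - 2) (x + k - 1) η) +
        bondCost g (x + k) (x + r) (swapConf x (x + k) (swapConf (x - 2) (x + k - 1) η)) +
        bondCost g x (x + k) (swapConf (x + k) (x + r)
          (swapConf x (x + k) (swapConf (x - 2) (x + k - 1) η))) +
        bondCost g (x - 2) (x + k - 1) (swapConf x (x + k) (swapConf (x + k) (x + r)
          (swapConf x (x + k) (swapConf (x - 2) (x + k - 1) η))))) := by
  have h1 := le_abs_self r
  have h2 := neg_le_abs r
  rw [← swapConf_eq_five_swaps (x := x) hr hr2 hk η]
  refine (ofReal_sq_sub_le_five _ (g (swapConf (x - 2) (x + k - 1) η))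
    (g (swapConf x (x + k) (swapConf (x - 2) (x + k - 1) η)))
    (g (swapConf (x + k) (x + r) (swapConf x (x + k) (swapConf (x - 2) (x + k - 1) η))))
    (g (swapConf x (x + k) (swapConf (x + k) (x + r)
      (swapConf x (x + k) (swapConf (x - 2) (x + k - 1) η))))) _).trans ?_
  gcongr
  · exact ofReal_sq_le_bondCost g (one_le_ctilde hη1 (by omega))
  · refine ofReal_sq_le_bondCost g (one_le_ctilde (z := x + k - 1) ?_ (by omega))
    simp only [swapConf]; grind
  · refine ofReal_sq_le_bondCost g (one_le_ctilde (z := x + k - 1) ?_ (by omega))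
    simp only [swapConf]; grind
  · refine ofReal_sq_le_bondCost g (one_le_ctilde (z := x + k - 1) ?_ (by omega))
    simp only [swapConf]; grind
  · refine ofReal_sq_le_bondCost g (one_le_ctilde (z := x - 1) ?_ (by omega))
    simp only [swapConf]; grind

lemma measurableSet_mobile (x : ℤ) :
    MeasurableSet {η : Config | η (x - 2) = true ∧ η (x - 1) = true} :=
  (measurableSet_eq_fun (measurable_pi_apply (x - 2)) measurable_const).inter
    (measurableSet_eq_fun (measurable_pi_apply (x - 1)) measurable_const)

lemma setLIntegral_sq_le_bond (g : Config → ℝ) (ν : Measure Config) (x r : ℤ) :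
    ∫⁻ η in {η : Config | η (x - 2) = true ∧ η (x - 1) = true},
      ENNReal.ofReal ((g (swapConf x (x + r) η) - g η) ^ 2) ∂ν ≤
      ∫⁻ η, bondCost g x (x + r) η ∂ν :=
  (setLIntegral_mono' (measurableSet_mobile x) fun _ hη =>
    ofReal_sq_le_bondCost g (one_le_ctilde hη.2 (Or.inl rfl))).trans (setLIntegral_le_lintegral _ _)

lemma setLIntegral_sq_le_path {b : ℝ} {ν : Measure Config} (hν : IsBernoulliProduct b ν)
    {g : Config → ℝ} (hg : Measurable g) {x r k : ℤ} (hr : r ≠ 0) (hr1 : r ≠ -1)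
    (hr2 : r ≠ -2) (hk : |r| + 2 ≤ k) :
    ∫⁻ η in {η : Config | η (x - 2) = true ∧ η (x - 1) = true},
      ENNReal.ofReal ((g (swapConf x (x + r) η) - g η) ^ 2) ∂ν ≤
      5 * (2 * ∫⁻ η, bondCost g (x - 2) (x + k - 1) η ∂ν + 2 * ∫⁻ η, bondCost g x (x + k) η ∂ν +
        ∫⁻ η, bondCost g (x + k) (x + r) η ∂ν) := by
  refine (setLIntegral_mono' (measurableSet_mobile x) fun η hη =>
    ofReal_sq_le_path g hr hr1 hr2 hk hη.1 hη.2).trans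
    ((setLIntegral_le_lintegral _ _).trans_eq ?_)
  have m := measurable_bondCost hg
  have p₁ := hν.measurePreserving_swapConf (x - 2) (x + k - 1)
  have p₂ := (hν.measurePreserving_swapConf x (x + k)).comp p₁
  have p₃ := (hν.measurePreserving_swapConf (x + k) (x + r)).comp p₂
  have p₄ := (hν.measurePreserving_swapConf x (x + k)).comp p₃
  have e₁ := p₁.lintegral_comp (m x (x + k))
  have e₂ := p₂.lintegral_comp (m (x + k) (x + r))
  have e₃ := p₃.lintegral_comp (m x (x + k))
  have e₄ := p₄.lintegral_comp (m (x - 2) (x + k - 1))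
  have m₁ := (m x (x + k)).comp p₁.measurable
  have m₂ := (m (x + k) (x + r)).comp p₂.measurable
  have m₃ := (m x (x + k)).comp p₃.measurable
  have m₄ := (m (x - 2) (x + k - 1)).comp p₄.measurable
  simp only [Function.comp_def] at e₁ e₂ e₃ e₄ m₁ m₂ m₃ m₄
  rw [lintegral_const_mul' _ _ (by simp), lintegral_add_right _ m₄, lintegral_add_right _ m₃,
    lintegral_add_right _ m₂, lintegral_add_right _ m₁, e₁, e₂, e₃, e₄]
  ring

lemma le_mul_transP_mul {γ : ℝ} (hγ : 0 < γ) {z : ℤ} (hz : z ≠ 0) {L : ℝ}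
    (hL : |(z : ℝ)| ≤ L) (J : ℝ≥0∞) :
    J ≤ ENNReal.ofReal (L ^ (γ + 1) / cGamma γ) * (ENNReal.ofReal (transP γ z) * J) := by
  have hL0 : 0 ≤ L := (abs_nonneg _).trans hL
  have hc := cGamma_pos hγ
  rw [← mul_assoc, ← ENNReal.ofReal_mul (by positivity)]
  exact le_mul_of_one_le_left' (ENNReal.one_le_ofReal.2 (one_le_mul_transP hγ hz hL))

lemma tsum_sum_le_of_injective {α β ι : Type*} (K : Finset β) {φ : α × β → ι}
    (hφ : Function.Injective φ) (J w : ι → ℝ≥0∞) (M : ℝ≥0∞)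
    (h : ∀ x, ∀ k ∈ K, J (φ (x, k)) ≤ M * w (φ (x, k))) :
    ∑' x, ∑ k ∈ K, J (φ (x, k)) ≤ M * ∑' i, w i :=
  calc ∑' x, ∑ k ∈ K, J (φ (x, k))
      ≤ ∑' x, ∑' k, M * w (φ (x, k)) :=
        ENNReal.tsum_le_tsum fun x => (Finset.sum_le_sum (h x)).trans (ENNReal.sum_le_tsum K)
    _ = M * ∑' p : α × β, w (φ p) := by
        rw [← ENNReal.tsum_prod, ENNReal.tsum_mul_left]
    _ ≤ M * ∑' i, w i := by
        gcongr
        exact ENNReal.tsum_comp_le_tsum_of_injective hφ w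

/-- Moving Particle Lemma. -/
theorem statement10 (γ : ℝ) (hγ : γ ∈ Set.Ioo (0 : ℝ) 2) :
    ∃ C : ℝ, 0 < C ∧
      ∀ b : ℝ, b ∈ Set.Ioo (0 : ℝ) 1 →
      ∀ ν : MeasureTheory.Measure Config, IsBernoulliProduct b ν →
      ∀ r : ℤ, r ≠ 0 →
      ∀ f : Config → ℝ, Measurable f → (∀ η : Config, 0 ≤ f η) → (∫ η, f η ∂ν) = 1 →
        ∑' x : ℤ,
          ∫⁻ η in {η : Config | η (x - 2) = true ∧ η (x - 1) = true},
            ENNReal.ofReal ((Real.sqrt (f (swapConf x (x + r) η)) - Real.sqrt (f η)) ^ 2) ∂ν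
        ≤ ENNReal.ofReal (C * |(r : ℝ)| ^ γ) * dirichletForm γ ν f := by
  have hγ0 : 0 < γ := hγ.1
  have hc := cGamma_pos hγ0
  refine ⟨100 * (4 ^ (γ + 1) / cGamma γ), by positivity, ?_⟩
  intro b _ ν hν r hr f hf _ _
  set g : Config → ℝ := fun η => Real.sqrt (f η) with hgdef
  have hg : Measurable g := hf.sqrt
  set J : ℤ × ℤ → ℝ≥0∞ := fun q => ∫⁻ η, bondCost g q.1 q.2 η ∂ν with hJ
  set w : ℤ × ℤ → ℝ≥0∞ := fun q => ENNReal.ofReal (transP γ (q.1 - q.2)) * J q with hw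
  have hD : ENNReal.ofReal 4 * dirichletForm γ ν f = ∑' q, w q := by
    change ENNReal.ofReal 4 * (1 / 4 * ∑' q, w q) = _
    rw [← mul_assoc, show ENNReal.ofReal 4 = 4 by simp, one_div,
      ENNReal.mul_inv_cancel (by simp) (by simp), one_mul]
  have hr1 : (1 : ℝ) ≤ |(r : ℝ)| := by exact_mod_cast Int.one_le_abs hr
  have hrpos : 0 < |(r : ℝ)| := by linarith
  have hJw : ∀ (L : ℝ) (q : ℤ × ℤ), q.1 - q.2 ≠ 0 → |((q.1 - q.2 : ℤ) : ℝ)| ≤ L →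
      J q ≤ ENNReal.ofReal (L ^ (γ + 1) / cGamma γ) * w q :=
    fun L q hq hL => le_mul_transP_mul hγ0 hq hL (J q)
  set M := ENNReal.ofReal ((4 * |(r : ℝ)|) ^ (γ + 1) / cGamma γ) with hM
  have hMeq : M = ENNReal.ofReal |(r : ℝ)| *
      ENNReal.ofReal (4 ^ (γ + 1) / cGamma γ * |(r : ℝ)| ^ γ) := by
    rw [hM, ← ENNReal.ofReal_mul hrpos.le, Real.mul_rpow (by norm_num) hrpos.le,
      Real.rpow_add_one hrpos.ne']
    congr 1
    ring
  have hgoal : ENNReal.ofReal (100 * (4 ^ (γ + 1) / cGamma γ) * |(r : ℝ)| ^ γ) *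
      dirichletForm γ ν f = 25 * (ENNReal.ofReal (4 ^ (γ + 1) / cGamma γ * |(r : ℝ)| ^ γ) *
        ∑' q, w q) := by
    rw [← hD, show (25 : ℝ≥0∞) = ENNReal.ofReal 25 by simp, ← mul_assoc, ← mul_assoc,
      ← ENNReal.ofReal_mul (by norm_num), ← ENNReal.ofReal_mul (by positivity)]
    congr 2
    ring
  rw [hgoal]
  by_cases hsmall : r = -1 ∨ r = -2
  · have hinj : Function.Injective fun x : ℤ => (x, x + r) := fun x y h => (Prod.ext_iff.1 h).1
    have hr4 : |(r : ℝ)| ≤ 4 := by rcases hsmall with rfl | rfl <;> norm_num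
    calc _ ≤ ∑' x : ℤ, ENNReal.ofReal (4 ^ (γ + 1) / cGamma γ) * w (x, x + r) :=
          ENNReal.tsum_le_tsum fun x => (setLIntegral_sq_le_bond g ν x r).trans
            (hJw 4 (x, x + r) (by simpa using hr) (by simpa using hr4))
      _ ≤ ENNReal.ofReal (4 ^ (γ + 1) / cGamma γ) * ∑' q, w q := by
          rw [ENNReal.tsum_mul_left]
          gcongr
          exact ENNReal.tsum_comp_le_tsum_of_injective hinj w
      _ ≤ 1 * (ENNReal.ofReal (4 ^ (γ + 1) / cGamma γ * |(r : ℝ)| ^ γ) * ∑' q, w q) := by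
          rw [one_mul]
          gcongr
          exact le_mul_of_one_le_right (by positivity) (Real.one_le_rpow hr1 hγ0.le)
      _ ≤ _ := by gcongr; norm_num
  · push Not at hsmall
    set K := Finset.Icc (|r| + 2) (2 * |r| + 1) with hK
    have hcard : (K.card : ℝ≥0∞) = ENNReal.ofReal |(r : ℝ)| := by
      rw [← ENNReal.ofReal_natCast, hK, Int.card_Icc]
      congr 1
      have : ((2 * |r| + 1 + 1 - (|r| + 2)).toNat : ℤ) = |r| := by
        rw [Int.toNat_of_nonneg] <;> linarith [abs_nonneg r]
      exact_mod_cast this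
    have hdist : ∀ q : ℤ × ℤ, q.1 - q.2 ≠ 0 → |q.1 - q.2| ≤ 4 * |r| → J q ≤ M * w q :=
      fun q hq hL => hJw _ q hq (by exact_mod_cast hL)
    have ha := le_abs_self r
    have hb := neg_le_abs r
    have hr1' := Int.one_le_abs hr
    have s₁ : ∑' x : ℤ, ∑ k ∈ K, J (x - 2, x + k - 1) ≤ M * ∑' q, w q := by
      refine tsum_sum_le_of_injective K (φ := fun p : ℤ × ℤ => (p.1 - 2, p.1 + p.2 - 1))
        ?_ J w M fun x k hk => ?_
      · rintro ⟨x, k⟩ ⟨x', k'⟩ h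
        simp only [Prod.mk.injEq] at h ⊢
        omega
      · rw [hK, Finset.mem_Icc] at hk
        exact hdist _ (by simp only; omega) (abs_le.2 ⟨by simp only; omega, by simp only; omega⟩)
    have s₂ : ∑' x : ℤ, ∑ k ∈ K, J (x, x + k) ≤ M * ∑' q, w q := by
      refine tsum_sum_le_of_injective K (φ := fun p : ℤ × ℤ => (p.1, p.1 + p.2))
        ?_ J w M fun x k hk => ?_
      · rintro ⟨x, k⟩ ⟨x', k'⟩ h
        simp only [Prod.mk.injEq] at h ⊢
        omega
      · rw [hK, Finset.mem_Icc] at hk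
        exact hdist _ (by simp only; omega) (abs_le.2 ⟨by simp only; omega, by simp only; omega⟩)
    have s₃ : ∑' x : ℤ, ∑ k ∈ K, J (x + k, x + r) ≤ M * ∑' q, w q := by
      refine tsum_sum_le_of_injective K (φ := fun p : ℤ × ℤ => (p.1 + p.2, p.1 + r))
        ?_ J w M fun x k hk => ?_
      · rintro ⟨x, k⟩ ⟨x', k'⟩ h
        simp only [Prod.mk.injEq] at h ⊢
        omega
      · rw [hK, Finset.mem_Icc] at hk
        exact hdist _ (by simp only; omega) (abs_le.2 ⟨by simp only; omega, by simp only; omega⟩)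
    have hN0 : ENNReal.ofReal |(r : ℝ)| ≠ 0 := (ENNReal.ofReal_pos.2 hrpos).ne'
    rw [← ENNReal.mul_le_mul_iff_right hN0 ENNReal.ofReal_ne_top]
    calc _ = ∑' x : ℤ, ∑ k ∈ K, ∫⁻ η in {η : Config | η (x - 2) = true ∧ η (x - 1) = true},
            ENNReal.ofReal ((g (swapConf x (x + r) η) - g η) ^ 2) ∂ν := by
          simp only [Finset.sum_const, nsmul_eq_mul, hcard, ENNReal.tsum_mul_left, hgdef]
      _ ≤ ∑' x : ℤ, ∑ k ∈ K,
            5 * (2 * J (x - 2, x + k - 1) + 2 * J (x, x + k) + J (x + k, x + r)) :=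
          ENNReal.tsum_le_tsum fun x => Finset.sum_le_sum fun k hk =>
            setLIntegral_sq_le_path hν hg hr hsmall.1 hsmall.2 (Finset.mem_Icc.1 hk).1
      _ = 5 * (2 * ∑' x : ℤ, ∑ k ∈ K, J (x - 2, x + k - 1) +
            2 * ∑' x : ℤ, ∑ k ∈ K, J (x, x + k) + ∑' x : ℤ, ∑ k ∈ K, J (x + k, x + r)) := by
          simp only [← Finset.mul_sum, Finset.sum_add_distrib, ENNReal.tsum_mul_left,
            ENNReal.tsum_add]
      _ ≤ 5 * (2 * (M * ∑' q, w q) + 2 * (M * ∑' q, w q) + M * ∑' q, w q) := by gcongr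
      _ = _ := by rw [hMeq]; ring
end
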